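/- For every ρ > 2 there is a constant C'(ρ) with the following property. Let N be a sufficiently large prime, let b ≤ W be positive integers with gcd(b,W) = 1 and W ≤ log log N, let A ⊆ {1, …, N}, and define a: ℤ_N → ℝ by a(x) = 1_A(x)·λ_{b,W}(x)/N. Then Σ_{r=1}^{N} |ã(r)|^ρ ≤ C'(ρ). -/

import Mathlib

open Finset

/-- `e(t) = exp(2πit)`. -/
noncomputable def eC (t : ℝ) : ℂ := Complex.exp (2 * Real.pi * Complex.I * t)

/-- `λ_{b,W}(x) = (φ(W)/W)·log(Wx+b)` if `Wx+b` is prime, and `0` otherwise. -/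
noncomputable def lam (b W x : ℕ) : ℝ :=
  if Nat.Prime (W * x + b) then ((Nat.totient W : ℝ) / W) * Real.log (W * x + b) else 0

/-- The (unnormalized) Fourier transform `f̃(r) = Σ_{x=1}^{N} f(x) e(−xr/N)`
of a function `f : ℤ_N → ℝ`. -/
noncomputable def dft (N : ℕ) (f : ZMod N → ℝ) (r : ZMod N) : ℂ :=
  ∑ x ∈ Finset.Icc 1 N, (f ((x : ℕ) : ZMod N) : ℂ) *
    eC (-(((x : ℕ) : ℝ) * ((r.val : ℕ) : ℝ)) / N)

section RamanujanSum

open ArithmeticFunction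

/-- The function `d ↦ d·1_{d ∣ x}`. -/
noncomputable def dvdMul (x : ℤ) : ArithmeticFunction ℝ :=
  ⟨fun d => if (d : ℤ) ∣ x then (d : ℝ) else 0, by simp⟩

/-- The Ramanujan sum `c_q(x)` as an arithmetic function of `q`. -/
noncomputable def ramanujanSum (x : ℤ) : ArithmeticFunction ℝ :=
  (moebius : ArithmeticFunction ℝ) * dvdMul x

theorem dvdMul_apply (x : ℤ) (d : ℕ) :
    dvdMul x d = if (d : ℤ) ∣ x then (d : ℝ) else 0 := rfl

theorem isMultiplicative_dvdMul (x : ℤ) : (dvdMul x).IsMultiplicative := by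
  refine ⟨by simp [dvdMul_apply], ?_⟩
  intro m n h
  have : ((m * n : ℕ) : ℤ) ∣ x ↔ (m : ℤ) ∣ x ∧ (n : ℤ) ∣ x := by
    push_cast
    exact ⟨fun h => ⟨dvd_of_mul_right_dvd h, dvd_of_mul_left_dvd h⟩,
      fun h' => IsCoprime.mul_dvd (Nat.isCoprime_iff_coprime.2 h) h'.1 h'.2⟩
  simp only [dvdMul_apply, this]
  by_cases h1 : (m : ℤ) ∣ x <;> by_cases h2 : (n : ℤ) ∣ x <;> simp [h1, h2]

theorem isMultiplicative_ramanujanSum (x : ℤ) : (ramanujanSum x).IsMultiplicative :=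
  isMultiplicative_moebius.intCast.mul (isMultiplicative_dvdMul x)

theorem sum_divisors_ramanujanSum (x : ℤ) (n : ℕ) :
    ∑ d ∈ n.divisors, ramanujanSum x d = if (n : ℤ) ∣ x then (n : ℝ) else 0 := by
  rw [← dvdMul_apply, ← coe_zeta_mul_apply, ramanujanSum, ← mul_assoc,
    coe_zeta_mul_coe_moebius, one_mul]

theorem ramanujanSum_of_dvd {x : ℤ} {n : ℕ} (h : (n : ℤ) ∣ x) :
    ramanujanSum x n = Nat.totient n := by
  rcases Nat.eq_zero_or_pos n with rfl | hn
  · simp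
  induction n using Nat.strong_induction_on with
  | _ n ih =>
    have h1 := sum_divisors_ramanujanSum x n
    rw [if_pos h, ← Nat.cons_self_properDivisors hn.ne', Finset.sum_cons,
      Finset.sum_congr rfl (fun d hd => ih d (Nat.mem_properDivisors.1 hd).2
        ((Int.natCast_dvd_natCast.2 (Nat.mem_properDivisors.1 hd).1).trans h)
        (Nat.pos_of_mem_properDivisors hd))] at h1
    have h2 := congrArg (Nat.cast (R := ℝ)) (Nat.sum_totient n)
    rw [← Nat.cons_self_properDivisors hn.ne', Finset.sum_cons] at h2
    push_cast at h2
    linarith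

theorem ramanujanSum_congr {x y : ℤ} {q : ℕ} (h : ∀ d ∈ q.divisors, (d : ℤ) ∣ x ↔ (d : ℤ) ∣ y) :
    ramanujanSum x q = ramanujanSum y q := by
  simp only [ramanujanSum, mul_apply]
  refine Finset.sum_congr rfl fun p hp => ?_
  obtain ⟨h1, h2⟩ := Nat.mem_divisorsAntidiagonal.1 hp
  have := h p.2 (Nat.mem_divisors.2 ⟨Dvd.intro_left p.1 h1, h2⟩)
  simp only [dvdMul_apply, this]

theorem ramanujanSum_mul_left {w x : ℤ} {q : ℕ} (h : IsCoprime w (q : ℤ)) :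
    ramanujanSum (w * x) q = ramanujanSum x q := by
  refine ramanujanSum_congr fun d hd => ?_
  have hd' : (d : ℤ) ∣ q := Int.natCast_dvd_natCast.2 (Nat.dvd_of_mem_divisors hd)
  exact ⟨(h.of_isCoprime_of_dvd_right hd').symm.dvd_of_dvd_mul_left, fun h => h.mul_left w⟩

theorem ramanujanSum_of_isCoprime {x : ℤ} {q : ℕ} (h : IsCoprime x (q : ℤ)) :
    ramanujanSum x q = moebius q := by
  have h1 : ramanujanSum x q = ramanujanSum 1 q := by
    simpa using ramanujanSum_mul_left (x := 1) h
  rw [h1]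
  have : dvdMul 1 = 1 := by
    ext d
    by_cases hd : d = 1
    · simp [hd, dvdMul_apply]
    · have : ¬ (d : ℤ) ∣ 1 := by
        rw [Int.natCast_dvd]; simpa using hd
      simp [dvdMul_apply, one_apply, hd, this]
  rw [ramanujanSum, this, mul_one]
  simp

/-- The Ramanujan sum `c_q(x)` is the sum of the `x`-th powers of the primitive roots of order `q`. -/
theorem ofReal_ramanujanSum (x : ℤ) {q : ℕ} (hq : 0 < q) :
    (ramanujanSum x q : ℂ) = ∑ ζ ∈ primitiveRoots q ℂ, ζ ^ x := by
  induction q using Nat.strong_induction_on with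
  | _ q ih =>
    have h1 : (∑ d ∈ q.divisors, (ramanujanSum x d : ℂ)) =
        ∑ d ∈ q.divisors, ∑ ζ ∈ primitiveRoots d ℂ, ζ ^ x := by
      have h2 := congrArg (Complex.ofReal) (sum_divisors_ramanujanSum x q)
      rw [Complex.ofReal_sum] at h2
      rw [h2]
      have : NeZero q := ⟨hq.ne'⟩
      rw [← Finset.sum_biUnion (fun a _ b _ hab => IsPrimitiveRoot.disjoint hab),
        ← IsPrimitiveRoot.nthRoots_one_eq_biUnion_primitiveRoots]
      set ω := Complex.exp (2 * Real.pi * Complex.I / q) with hω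
      have hp : IsPrimitiveRoot ω q := Complex.isPrimitiveRoot_exp q hq.ne'
      have h3 : Polynomial.nthRootsFinset q (1 : ℂ) =
          (Finset.range q).image (fun i => ω ^ i) := by
        ext z
        rw [Polynomial.mem_nthRootsFinset hq, Finset.mem_image]
        constructor
        · intro hz
          obtain ⟨i, hi, rfl⟩ := hp.eq_pow_of_pow_eq_one hz
          exact ⟨i, Finset.mem_range.2 hi, rfl⟩
        · rintro ⟨i, -, rfl⟩
          rw [← pow_mul, mul_comm, pow_mul, hp.pow_eq_one, one_pow]
      rw [h3, Finset.sum_image (fun i hi j hj h => hp.pow_inj (Finset.mem_range.1 hi)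
        (Finset.mem_range.1 hj) h)]
      have h4 : ∀ i ∈ Finset.range q, (ω ^ i) ^ x = (ω ^ x) ^ i := by
        intro i _
        rw [← zpow_natCast, ← zpow_mul, mul_comm, zpow_mul, zpow_natCast]
      rw [Finset.sum_congr rfl h4]
      by_cases hx : (q : ℤ) ∣ x
      · rw [if_pos hx, (hp.zpow_eq_one_iff_dvd x).2 hx]; simp
      · rw [if_neg hx]
        have hne : ω ^ x ≠ 1 := fun h => hx ((hp.zpow_eq_one_iff_dvd x).1 h)
        rw [geom_sum_eq hne, ← zpow_natCast, ← zpow_mul, mul_comm, zpow_mul, zpow_natCast,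
          hp.pow_eq_one]
        simp
    rw [← Nat.cons_self_properDivisors hq.ne', Finset.sum_cons, Finset.sum_cons,
      Finset.sum_congr rfl (fun d hd => ih d (Nat.mem_properDivisors.1 hd).2
        (Nat.pos_of_mem_properDivisors hd))] at h1
    exact add_right_cancel h1

end RamanujanSum

/-- `|Σ_{u<n} z^u|²`. -/
noncomputable def fejer (n : ℕ) (z : ℂ) : ℝ := ‖∑ u ∈ range n, z ^ u‖ ^ 2

theorem fejer_nonneg (n : ℕ) (z : ℂ) : 0 ≤ fejer n z := by
  unfold fejer; positivity

theorem sum_sum_zpow_sub {z : ℂ} (hz : ‖z‖ = 1) (n : ℕ) :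
    ∑ u ∈ range n, ∑ v ∈ range n, z ^ ((u : ℤ) - v) = (fejer n z : ℂ) := by
  have hz0 : z ≠ 0 := by rintro rfl; simp at hz
  have hinv : (starRingEnd ℂ) z = z⁻¹ := (Complex.inv_eq_conj hz).symm
  rw [fejer, ← Complex.normSq_eq_norm_sq, ← Complex.mul_conj, map_sum, Finset.sum_mul_sum]
  refine Finset.sum_congr rfl fun u _ => Finset.sum_congr rfl fun v _ => ?_
  rw [zpow_sub₀ hz0, map_pow, hinv, zpow_natCast, zpow_natCast, inv_pow, div_eq_mul_inv]

theorem sum_zpow_mul_norm_sq {ι : Type*} (s : Finset ι) (α z : ι → ℂ)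
    (hz : ∀ i ∈ s, ‖z i‖ = 1) {ζ : ℂ} (hζ : ‖ζ‖ = 1) (n : ℕ) :
    ∑ u ∈ range n, ∑ v ∈ range n,
      ζ ^ ((u : ℤ) - v) * ((‖∑ i ∈ s, α i * z i ^ ((u : ℤ) - v)‖ ^ 2 : ℝ) : ℂ) =
    ∑ i ∈ s, ∑ j ∈ s, α i * (starRingEnd ℂ) (α j) *
      (fejer n (ζ * (z i * (starRingEnd ℂ) (z j))) : ℂ) := by
  have h1 : ∀ x : ℤ, ζ ^ x * ((‖∑ i ∈ s, α i * z i ^ x‖ ^ 2 : ℝ) : ℂ) =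
      ∑ i ∈ s, ∑ j ∈ s, α i * (starRingEnd ℂ) (α j) *
        (ζ * (z i * (starRingEnd ℂ) (z j))) ^ x := by
    intro x
    rw [← Complex.normSq_eq_norm_sq, ← Complex.mul_conj, map_sum, Finset.sum_mul_sum,
      Finset.mul_sum]
    refine Finset.sum_congr rfl fun i _ => ?_
    rw [Finset.mul_sum]
    refine Finset.sum_congr rfl fun j _ => ?_
    rw [mul_zpow, mul_zpow, map_mul, map_zpow₀]
    ring
  simp only [h1]
  simp only [Finset.sum_comm (s := range n) (t := s)]
  refine Finset.sum_congr rfl fun i hi => Finset.sum_congr rfl fun j hj => ?_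
  rw [← sum_sum_zpow_sub, Finset.mul_sum]
  · exact Finset.sum_congr rfl fun u _ => (Finset.mul_sum ..).symm
  · simp [hζ, hz i hi, hz j hj]

theorem sum_norm_sq {ι : Type*} (s : Finset ι) (α z : ι → ℂ)
    (hz : ∀ i ∈ s, ‖z i‖ = 1) (n : ℕ) :
    ((∑ u ∈ range n, ∑ v ∈ range n, ‖∑ i ∈ s, α i * z i ^ ((u : ℤ) - v)‖ ^ 2 : ℝ) : ℂ) =
    ∑ i ∈ s, ∑ j ∈ s, α i * (starRingEnd ℂ) (α j) *
      (fejer n (z i * (starRingEnd ℂ) (z j)) : ℂ) := by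
  have := sum_zpow_mul_norm_sq s α z hz (ζ := 1) (by simp) n
  simp only [one_zpow, one_mul] at this
  rw [← this]
  push_cast
  rfl

/-- Majorant property: enlarging the coefficients to nonnegative ones increases the `L²` norm. -/
theorem sum_norm_sq_le_of_norm_le {ι : Type*} (s : Finset ι) (α z : ι → ℂ) (β : ι → ℝ)
    (hz : ∀ i ∈ s, ‖z i‖ = 1) (hαβ : ∀ i ∈ s, ‖α i‖ ≤ β i) (n : ℕ) :
    ∑ u ∈ range n, ∑ v ∈ range n, ‖∑ i ∈ s, α i * z i ^ ((u : ℤ) - v)‖ ^ 2 ≤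
    ∑ u ∈ range n, ∑ v ∈ range n, ‖∑ i ∈ s, (β i : ℂ) * z i ^ ((u : ℤ) - v)‖ ^ 2 := by
  have h2 : ∑ u ∈ range n, ∑ v ∈ range n, ‖∑ i ∈ s, (β i : ℂ) * z i ^ ((u : ℤ) - v)‖ ^ 2 =
      ∑ i ∈ s, ∑ j ∈ s, β i * β j * fejer n (z i * (starRingEnd ℂ) (z j)) := by
    apply Complex.ofReal_injective
    rw [sum_norm_sq s (fun i => (β i : ℂ)) z hz n]
    push_cast
    simp
  rw [h2]
  refine (Real.le_norm_self _).trans ?_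
  rw [← Complex.norm_real, sum_norm_sq s α z hz n]
  refine (norm_sum_le _ _).trans (Finset.sum_le_sum fun i hi => ?_)
  refine (norm_sum_le _ _).trans (Finset.sum_le_sum fun j hj => ?_)
  rw [norm_mul, norm_mul, RCLike.norm_conj, Complex.norm_real, Real.norm_of_nonneg (fejer_nonneg _ _)]
  have hi' := (norm_nonneg _).trans (hαβ i hi)
  gcongr
  · exact fejer_nonneg _ _
  · exact hαβ i hi
  · exact hαβ j hj

/-- The functional `h ↦ Σ_{u,v<n} h(u-v) |Σ_{i ∈ s} z_i^{u-v}|²`. -/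
noncomputable def energy {ι : Type*} (s : Finset ι) (z : ι → ℂ) (n : ℕ) (h : ℤ → ℝ) : ℝ :=
  ∑ u ∈ range n, ∑ v ∈ range n, h ((u : ℤ) - v) * ‖∑ i ∈ s, z i ^ ((u : ℤ) - v)‖ ^ 2

section Energy

variable {ι : Type*} {s : Finset ι} {z : ι → ℂ} {n : ℕ}

theorem energy_sum {κ : Type*} (t : Finset κ) (h : κ → ℤ → ℝ) :
    energy s z n (fun x => ∑ k ∈ t, h k x) = ∑ k ∈ t, energy s z n (h k) := by
  simp only [energy, Finset.sum_mul]
  simp only [Finset.sum_comm (s := range n) (t := t)]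

theorem energy_const_mul (c : ℝ) (h : ℤ → ℝ) :
    energy s z n (fun x => c * h x) = c * energy s z n h := by
  simp only [energy, Finset.mul_sum, mul_assoc]

/-- The energy of a sum of characters is a sum of values of the Fejér kernel. -/
theorem energy_eq_sum_fejer {κ : Type*} (t : Finset κ) (ω : κ → ℂ) (h : ℤ → ℝ)
    (hz : ∀ i ∈ s, ‖z i‖ = 1) (hω : ∀ k ∈ t, ‖ω k‖ = 1)
    (hh : ∀ x, (h x : ℂ) = ∑ k ∈ t, ω k ^ x) :
    energy s z n h = ∑ k ∈ t, ∑ i ∈ s, ∑ j ∈ s,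
      fejer n (ω k * (z i * (starRingEnd ℂ) (z j))) := by
  apply Complex.ofReal_injective
  have h1 : ((energy s z n h : ℝ) : ℂ) = ∑ k ∈ t, ∑ u ∈ range n, ∑ v ∈ range n,
      ω k ^ ((u : ℤ) - v) * ((‖∑ i ∈ s, z i ^ ((u : ℤ) - v)‖ ^ 2 : ℝ) : ℂ) := by
    rw [energy]
    simp only [Complex.ofReal_sum, Complex.ofReal_mul, hh, Finset.sum_mul]
    simp only [Finset.sum_comm (s := range n) (t := t)]
  rw [h1]
  simp only [Complex.ofReal_sum]
  refine Finset.sum_congr rfl fun k hk => ?_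
  have := sum_zpow_mul_norm_sq s (fun _ => 1) z hz (hω k hk) n
  simpa using this

theorem energy_nonneg_of_characters {κ : Type*} (t : Finset κ) (ω : κ → ℂ) (h : ℤ → ℝ)
    (hz : ∀ i ∈ s, ‖z i‖ = 1) (hω : ∀ k ∈ t, ‖ω k‖ = 1)
    (hh : ∀ x, (h x : ℂ) = ∑ k ∈ t, ω k ^ x) : 0 ≤ energy s z n h := by
  rw [energy_eq_sum_fejer t ω h hz hω hh]
  exact Finset.sum_nonneg fun _ _ => Finset.sum_nonneg fun _ _ => Finset.sum_nonneg fun _ _ =>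
    fejer_nonneg _ _

theorem norm_of_mem_primitiveRoots {q : ℕ} (hq : 0 < q) {ζ : ℂ} (h : ζ ∈ primitiveRoots q ℂ) :
    ‖ζ‖ = 1 :=
  ((mem_primitiveRoots hq).1 h).norm'_eq_one hq.ne'

theorem energy_ramanujanSum (hz : ∀ i ∈ s, ‖z i‖ = 1) {q : ℕ} (hq : 0 < q) :
    energy s z n (fun x => ramanujanSum x q) = ∑ ζ ∈ primitiveRoots q ℂ, ∑ i ∈ s, ∑ j ∈ s,
      fejer n (ζ * (z i * (starRingEnd ℂ) (z j))) :=
  energy_eq_sum_fejer _ (fun ζ => ζ) _ hz (fun _ h => norm_of_mem_primitiveRoots hq h)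
    fun x => ofReal_ramanujanSum x hq

theorem energy_ramanujanSum_nonneg (hz : ∀ i ∈ s, ‖z i‖ = 1) {q : ℕ} (hq : 0 < q) :
    0 ≤ energy s z n (fun x => ramanujanSum x q) :=
  energy_nonneg_of_characters _ (fun ζ => ζ) _ hz (fun _ h => norm_of_mem_primitiveRoots hq h)
    fun x => ofReal_ramanujanSum x hq

theorem energy_ramanujanSum_mul_mul_nonneg (hz : ∀ i ∈ s, ‖z i‖ = 1) {a b c : ℕ}
    (ha : 0 < a) (hb : 0 < b) (hc : 0 < c) :
    0 ≤ energy s z n (fun x => ramanujanSum x a * ramanujanSum x b * ramanujanSum x c) := by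
  refine energy_nonneg_of_characters
    ((primitiveRoots a ℂ ×ˢ primitiveRoots b ℂ) ×ˢ primitiveRoots c ℂ)
    (fun k => k.1.1 * k.1.2 * k.2) _ hz ?_ ?_
  · intro k hk
    simp only [Finset.mem_product] at hk
    simp [norm_of_mem_primitiveRoots ha hk.1.1, norm_of_mem_primitiveRoots hb hk.1.2,
      norm_of_mem_primitiveRoots hc hk.2]
  · intro x
    push_cast
    rw [ofReal_ramanujanSum x ha, ofReal_ramanujanSum x hb, ofReal_ramanujanSum x hc,
      Finset.sum_mul_sum, ← Finset.sum_product', Finset.sum_mul_sum, ← Finset.sum_product']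
    exact Finset.sum_congr rfl fun k _ => by rw [mul_zpow, mul_zpow]

end Energy

section Product

variable {ι : Type*} {s : Finset ι} {z : ι → ℂ} {n : ℕ}

theorem energy_ramanujanSum_mul_le (hz : ∀ i ∈ s, ‖z i‖ = 1) {D a b : ℕ}
    (hD : 0 < D) (ha : 0 < a) (hb : 0 < b) (hDa : D.Coprime a) (hDb : D.Coprime b)
    (hab : a.Coprime b) :
    energy s z n (fun x => ramanujanSum x (D * a) * ramanujanSum x (D * b)) ≤
      D.totient * ∑ e ∈ D.divisors, energy s z n (fun x => ramanujanSum x (e * (a * b))) := by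
  have h1 : ∀ x, ramanujanSum x (D * a) * ramanujanSum x (D * b) =
      ramanujanSum x D * ramanujanSum x D * ramanujanSum x (a * b) := by
    intro x
    have hm := isMultiplicative_ramanujanSum x
    rw [hm.map_mul_of_coprime hDa, hm.map_mul_of_coprime hDb, hm.map_mul_of_coprime hab]
    ring
  have h2 : ∀ x, ∑ e ∈ D.divisors, ramanujanSum x e * ramanujanSum x D * ramanujanSum x (a * b) =
      D.totient * ∑ e ∈ D.divisors, ramanujanSum x (e * (a * b)) := by
    intro x
    have hm := isMultiplicative_ramanujanSum x
    have : ∑ e ∈ D.divisors, ramanujanSum x (e * (a * b)) =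
        (∑ e ∈ D.divisors, ramanujanSum x e) * ramanujanSum x (a * b) := by
      rw [Finset.sum_mul]
      refine Finset.sum_congr rfl fun e he => hm.map_mul_of_coprime ?_
      have hed := Nat.dvd_of_mem_divisors he
      exact Nat.Coprime.mul_right (hDa.coprime_dvd_left hed) (hDb.coprime_dvd_left hed)
    rw [this, ← Finset.sum_mul, ← Finset.sum_mul, sum_divisors_ramanujanSum]
    split_ifs with h
    · rw [ramanujanSum_of_dvd h]; ring
    · simp
  simp only [h1]
  calc energy s z n (fun x => ramanujanSum x D * ramanujanSum x D * ramanujanSum x (a * b))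
      ≤ ∑ e ∈ D.divisors, energy s z n
          (fun x => ramanujanSum x e * ramanujanSum x D * ramanujanSum x (a * b)) :=
        Finset.single_le_sum (f := fun e => energy s z n
          (fun x => ramanujanSum x e * ramanujanSum x D * ramanujanSum x (a * b)))
          (fun e he => energy_ramanujanSum_mul_mul_nonneg hz
          (Nat.pos_of_mem_divisors he) hD (Nat.mul_pos ha hb)) (Nat.mem_divisors_self D hD.ne')
    _ = _ := by
        rw [← energy_sum, ← energy_sum, ← energy_const_mul]
        simp only [h2]

/-- The weight `Σ_{q ∈ 𝒬} c_q(x)/q`. -/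
noncomputable def ramanujanWeight (𝒬 : Finset ℕ) (x : ℤ) : ℝ :=
  ∑ q ∈ 𝒬, (q : ℝ)⁻¹ * ramanujanSum x q

theorem energy_ramanujanWeight_sq_le (hz : ∀ i ∈ s, ‖z i‖ = 1) {𝒬 : Finset ℕ} {R : ℕ}
    (hsq : ∀ q ∈ 𝒬, Squarefree q) (hR : ∀ q ∈ 𝒬, q ≤ R)
    (hdvd : ∀ q ∈ 𝒬, ∀ d, d ∣ q → d ∈ 𝒬) :
    energy s z n (fun x => ramanujanWeight 𝒬 x ^ 2) ≤
      (∑ q ∈ 𝒬, (q : ℝ)⁻¹) * ∑ q ∈ Icc 1 (R ^ 2),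
        (#q.divisors ^ 2 * (q : ℝ)⁻¹) * energy s z n (fun x => ramanujanSum x q) := by
  set E : ℕ → ℝ := fun q => energy s z n (fun x => ramanujanSum x q) with hE
  have hpos : ∀ q ∈ 𝒬, 0 < q := fun q hq => Nat.pos_of_ne_zero (hsq q hq).ne_zero
  have hE0 : ∀ q, 0 < q → 0 ≤ E q := fun q hq => energy_ramanujanSum_nonneg hz hq
  have key : ∀ q₁ ∈ 𝒬, ∀ q₂ ∈ 𝒬,
      ((q₁ : ℝ)⁻¹ * (q₂ : ℝ)⁻¹) * energy s z n (fun x => ramanujanSum x q₁ * ramanujanSum x q₂) ≤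
      ∑ e ∈ (q₁.gcd q₂).divisors, ((q₁.gcd q₂ / e : ℕ) : ℝ)⁻¹ *
        ((e * (q₁ / q₁.gcd q₂ * (q₂ / q₁.gcd q₂)) : ℕ) : ℝ)⁻¹ *
          E (e * (q₁ / q₁.gcd q₂ * (q₂ / q₁.gcd q₂))) := by
    intro q₁ h₁ q₂ h₂
    set D := q₁.gcd q₂ with hD
    have hDpos : 0 < D := Nat.gcd_pos_of_pos_left _ (hpos _ h₁)
    have e₁ : D * (q₁ / D) = q₁ := Nat.mul_div_cancel' (Nat.gcd_dvd_left _ _)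
    have e₂ : D * (q₂ / D) = q₂ := Nat.mul_div_cancel' (Nat.gcd_dvd_right _ _)
    set a := q₁ / D with ha
    set b := q₂ / D with hb
    have hapos : 0 < a := Nat.pos_of_mul_pos_left (e₁ ▸ hpos _ h₁)
    have hbpos : 0 < b := Nat.pos_of_mul_pos_left (e₂ ▸ hpos _ h₂)
    have c₁ : D.Coprime a := Nat.coprime_of_squarefree_mul (e₁ ▸ hsq _ h₁)
    have c₂ : D.Coprime b := Nat.coprime_of_squarefree_mul (e₂ ▸ hsq _ h₂)
    have c₃ : a.Coprime b := Nat.coprime_div_gcd_div_gcd hDpos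
    have := energy_ramanujanSum_mul_le (n := n) hz hDpos hapos hbpos c₁ c₂ c₃
    rw [e₁, e₂] at this
    refine (mul_le_mul_of_nonneg_left this (by positivity)).trans ?_
    rw [← mul_assoc, Finset.mul_sum]
    refine Finset.sum_le_sum fun e he => ?_
    obtain ⟨d, hd⟩ := Nat.dvd_of_mem_divisors he
    have hepos := Nat.pos_of_mem_divisors he
    have hdpos : 0 < d := by
      rcases Nat.eq_zero_or_pos d with h | h
      · rw [h] at hd; omega
      · exact h
    have hde : D / e = d := by rw [hd, Nat.mul_div_cancel_left _ hepos]
    refine mul_le_mul_of_nonneg_right ?_ (hE0 _ (by positivity))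
    calc ((q₁ : ℝ)⁻¹ * (q₂ : ℝ)⁻¹) * D.totient ≤ ((q₁ : ℝ)⁻¹ * (q₂ : ℝ)⁻¹) * D := by
          gcongr; exact Nat.totient_le D
      _ = ((D / e : ℕ) : ℝ)⁻¹ * ((e * (a * b) : ℕ) : ℝ)⁻¹ := by
          rw [hde, ← e₁, ← e₂]
          have : (D : ℝ) = e * d := by rw [hd]; push_cast; ring
          push_cast
          rw [this]
          have h1 : (e : ℝ) ≠ 0 := by positivity
          have h2 : (d : ℝ) ≠ 0 := by positivity
          have h3 : (a : ℝ) ≠ 0 := by positivity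
          have h4 : (b : ℝ) ≠ 0 := by positivity
          field_simp
  set T : Finset (Σ _ : ℕ × ℕ, ℕ) := (𝒬 ×ˢ 𝒬).sigma (fun p => (p.1.gcd p.2).divisors) with hT
  set U : Finset (Σ _ : ℕ × ℕ, ℕ × ℕ) :=
    (𝒬 ×ˢ Icc 1 (R ^ 2)).sigma (fun p => p.2.divisors ×ˢ p.2.divisors) with hU
  set φ : (Σ _ : ℕ × ℕ, ℕ) → (Σ _ : ℕ × ℕ, ℕ × ℕ) := fun t =>
    ⟨((t.1.1.gcd t.1.2) / t.2,
      t.2 * (t.1.1 / t.1.1.gcd t.1.2 * (t.1.2 / t.1.1.gcd t.1.2))),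
      (t.2, t.1.1 / t.1.1.gcd t.1.2)⟩ with hφ
  set g : (Σ _ : ℕ × ℕ, ℕ × ℕ) → ℝ := fun u => (u.1.1 : ℝ)⁻¹ * (u.1.2 : ℝ)⁻¹ * E u.1.2 with hg
  have fact : ∀ t ∈ T, ∃ d e a b : ℕ, 0 < d ∧ 0 < e ∧ 0 < a ∧ 0 < b ∧
      t.1.1 = d * e * a ∧ t.1.2 = d * e * b ∧ t.2 = e ∧ t.1.1.gcd t.1.2 = d * e ∧
      φ t = ⟨(d, e * (a * b)), (e, a)⟩ ∧ d * e * a ∈ 𝒬 ∧ d * e * b ∈ 𝒬 := by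
    rintro ⟨⟨q₁, q₂⟩, e⟩ ht
    simp only [hT, Finset.mem_sigma, Finset.mem_product] at ht
    obtain ⟨⟨h₁, h₂⟩, he⟩ := ht
    obtain ⟨d, hd⟩ := Nat.dvd_of_mem_divisors he
    obtain ⟨a, ha⟩ := Nat.gcd_dvd_left q₁ q₂
    obtain ⟨b, hb⟩ := Nat.gcd_dvd_right q₁ q₂
    have p₁ := hpos _ h₁
    have p₂ := hpos _ h₂
    have hDpos : 0 < q₁.gcd q₂ := Nat.gcd_pos_of_pos_left _ p₁
    have hda : q₁ = d * e * a := by rw [mul_comm d e, ← hd]; exact ha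
    have hdb : q₂ = d * e * b := by rw [mul_comm d e, ← hd]; exact hb
    have hd' : q₁.gcd q₂ = d * e := by rw [hd, mul_comm]
    have q₁a : q₁ / q₁.gcd q₂ = a := by
      rw [Nat.div_eq_of_eq_mul_right hDpos ha]
    have q₂b : q₂ / q₁.gcd q₂ = b := by
      rw [Nat.div_eq_of_eq_mul_right hDpos hb]
    have hepos := Nat.pos_of_mem_divisors he
    have qd : q₁.gcd q₂ / e = d := Nat.div_eq_of_eq_mul_left hepos hd'
    refine ⟨d, e, a, b, ?_, hepos, ?_, ?_, hda, hdb, rfl, hd', ?_, hda ▸ h₁, hdb ▸ h₂⟩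
    · rcases Nat.eq_zero_or_pos d with h | h
      · simp [h] at hda; omega
      · exact h
    · rcases Nat.eq_zero_or_pos a with h | h
      · simp [h] at hda; omega
      · exact h
    · rcases Nat.eq_zero_or_pos b with h | h
      · simp [h] at hdb; omega
      · exact h
    · simp only [hφ, q₁a, q₂b, qd]
  have hmaps : ∀ t ∈ T, φ t ∈ U := by
    intro t ht
    obtain ⟨d, e, a, b, hd, he, ha, hb, -, -, -, -, h, m₁, m₂⟩ := fact t ht
    rw [h]
    have l₁ := hR _ m₁
    have l₂ := hR _ m₂
    simp only [hU, Finset.mem_sigma, Finset.mem_product, Finset.mem_Icc, Nat.mem_divisors]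
    refine ⟨⟨hdvd _ m₁ _ ⟨e * a, by ring⟩, Nat.mul_pos he (Nat.mul_pos ha hb), ?_⟩,
      ⟨⟨a * b, rfl⟩, by positivity⟩, ⟨e * b, by ring⟩, by positivity⟩
    calc e * (a * b) ≤ (d * e * a) * (d * e * b) := by
          have : 1 ≤ d * d * e := Nat.mul_pos (Nat.mul_pos hd hd) he
          calc e * (a * b) = 1 * (e * (a * b)) := by ring
            _ ≤ (d * d * e) * (e * (a * b)) := Nat.mul_le_mul_right _ this
            _ = _ := by ring
      _ ≤ R * R := Nat.mul_le_mul l₁ l₂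
      _ = R ^ 2 := by ring
  have hinj : Set.InjOn φ T := by
    intro t ht t' ht' h
    obtain ⟨d, e, a, b, hd, he, ha, hb, f1, f2, f3, -, h1, -, -⟩ := fact t ht
    obtain ⟨d', e', a', b', hd', he', ha', hb', f1', f2', f3', -, h1', -, -⟩ := fact t' ht'
    rw [h1, h1'] at h
    simp only [Sigma.mk.injEq, Prod.mk.injEq, heq_eq_eq] at h
    obtain ⟨⟨rfl, hq⟩, rfl, rfl⟩ := h
    have : b = b' := Nat.eq_of_mul_eq_mul_left ha (Nat.eq_of_mul_eq_mul_left he hq)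
    subst this
    obtain ⟨⟨_, _⟩, _⟩ := t
    obtain ⟨⟨_, _⟩, _⟩ := t'
    simp_all
  calc energy s z n (fun x => ramanujanWeight 𝒬 x ^ 2)
      = ∑ q₁ ∈ 𝒬, ∑ q₂ ∈ 𝒬, ((q₁ : ℝ)⁻¹ * (q₂ : ℝ)⁻¹) *
          energy s z n (fun x => ramanujanSum x q₁ * ramanujanSum x q₂) := by
        have : ∀ x, ramanujanWeight 𝒬 x ^ 2 = ∑ q₁ ∈ 𝒬, ∑ q₂ ∈ 𝒬, ((q₁ : ℝ)⁻¹ * (q₂ : ℝ)⁻¹) *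
            (ramanujanSum x q₁ * ramanujanSum x q₂) := by
          intro x
          rw [ramanujanWeight, pow_two, Finset.sum_mul_sum]
          exact Finset.sum_congr rfl fun _ _ => Finset.sum_congr rfl fun _ _ => by ring
        simp only [this, energy_sum, energy_const_mul]
    _ ≤ ∑ t ∈ T, g (φ t) := by
        rw [hT, Finset.sum_sigma, Finset.sum_product]
        exact Finset.sum_le_sum fun q₁ h₁ => Finset.sum_le_sum fun q₂ h₂ => key q₁ h₁ q₂ h₂
    _ = ∑ u ∈ T.image φ, g u := (Finset.sum_image hinj).symm
    _ ≤ ∑ u ∈ U, g u := by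
        refine Finset.sum_le_sum_of_subset_of_nonneg (Finset.image_subset_iff.2 hmaps) ?_
        intro u hu _
        simp only [hU, Finset.mem_sigma, Finset.mem_product, Finset.mem_Icc] at hu
        have := hE0 u.1.2 hu.1.2.1
        positivity
    _ = _ := by
        rw [hU, Finset.sum_sigma, Finset.sum_product, Finset.sum_mul_sum]
        refine Finset.sum_congr rfl fun d _ => Finset.sum_congr rfl fun q _ => ?_
        simp only [hg, Finset.sum_const, Finset.card_product, nsmul_eq_mul]
        push_cast
        ring

end Product

theorem one_le_mul_norm_sub_one {ω : ℂ} (hω : ‖ω‖ = 1) (h1 : ω ≠ 1) {m : ℕ} (hmpos : 0 < m)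
    (hm : ω ^ m = 1) : 1 ≤ m * ‖ω - 1‖ := by
  by_contra! h
  have hj : ∀ j : ℕ, ‖ω ^ j - 1‖ ≤ j * ‖ω - 1‖ := by
    intro j
    induction j with
    | zero => simp
    | succ j ih =>
      calc ‖ω ^ (j + 1) - 1‖ = ‖ω * (ω ^ j - 1) + (ω - 1)‖ := by ring_nf
        _ ≤ ‖ω * (ω ^ j - 1)‖ + ‖ω - 1‖ := norm_add_le _ _
        _ ≤ j * ‖ω - 1‖ + ‖ω - 1‖ := by rw [norm_mul, hω, one_mul]; gcongr
        _ = _ := by push_cast; ring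
  have h0 : ∑ j ∈ range m, ω ^ j = 0 := by rw [geom_sum_eq h1, hm]; simp
  have hre : 0 < (∑ j ∈ range m, ω ^ j).re := by
    rw [Complex.re_sum]
    refine Finset.sum_pos (fun j hjm => ?_) ⟨0, Finset.mem_range.2 hmpos⟩
    have h3 : ‖ω ^ j - 1‖ < 1 := by
      refine (hj j).trans_lt (lt_of_le_of_lt ?_ h)
      gcongr
      exact (Finset.mem_range.1 hjm).le
    have h4 := (Complex.abs_re_le_norm (ω ^ j - 1)).trans_lt h3
    rw [abs_lt] at h4
    simp at h4
    linarith [h4.1]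
  rw [h0] at hre
  simp at hre

theorem fejer_le_sq {z : ℂ} (hz : ‖z‖ = 1) (n : ℕ) : fejer n z ≤ (n : ℝ) ^ 2 := by
  unfold fejer
  gcongr
  refine (norm_sum_le _ _).trans ?_
  simp [hz]

theorem fejer_mul_le {z : ℂ} (hz : ‖z‖ = 1) (n : ℕ) : fejer n z * ‖z - 1‖ ^ 2 ≤ 4 := by
  have h : ‖(∑ u ∈ range n, z ^ u) * (z - 1)‖ ≤ 2 := by
    rw [geom_sum_mul]
    refine (norm_sub_le _ _).trans ?_
    rw [norm_pow, hz]; norm_num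
  rw [norm_mul] at h
  rw [fejer, ← mul_pow]
  calc _ ≤ (2 : ℝ) ^ 2 := by gcongr
    _ = 4 := by norm_num

theorem sum_fejer_primitiveRoots_le {w : ℂ} (hw : ‖w‖ = 1) (n M : ℕ) :
    ∑ q ∈ Icc 1 M, ∑ ζ ∈ primitiveRoots q ℂ, fejer n (ζ * w) ≤ (n : ℝ) ^ 2 + 16 * (M : ℝ) ^ 6 := by
  classical
  rw [← Finset.sum_biUnion (fun a _ b _ hab => IsPrimitiveRoot.disjoint hab)]
  set V := (Icc 1 M).biUnion (fun q => primitiveRoots q ℂ) with hV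
  have hVmem : ∀ ζ ∈ V, ∃ q, 0 < q ∧ q ≤ M ∧ IsPrimitiveRoot ζ q := by
    intro ζ hζ
    obtain ⟨q, hq, h⟩ := Finset.mem_biUnion.1 hζ
    rw [Finset.mem_Icc] at hq
    exact ⟨q, hq.1, hq.2, (mem_primitiveRoots hq.1).1 h⟩
  have hnorm : ∀ ζ ∈ V, ‖ζ‖ = 1 := by
    intro ζ hζ
    obtain ⟨q, hq, -, h⟩ := hVmem ζ hζ
    exact h.norm'_eq_one hq.ne'
  have hcard : #V ≤ M ^ 2 := by
    refine Finset.card_biUnion_le.trans ?_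
    calc ∑ q ∈ Icc 1 M, #(primitiveRoots q ℂ) ≤ ∑ q ∈ Icc 1 M, M := by
          refine Finset.sum_le_sum fun q hq => ?_
          rw [Complex.card_primitiveRoots]
          exact (Nat.totient_le q).trans (Finset.mem_Icc.1 hq).2
      _ = M ^ 2 := by simp [pow_two]
  set P : ℂ → Prop := fun ζ => ‖ζ * w - 1‖ * (2 * (M : ℝ) ^ 2) < 1 with hP
  rw [← Finset.sum_filter_add_sum_filter_not V P]
  have hnear : #(V.filter P) ≤ 1 := by
    rw [Finset.card_le_one]
    intro ζ hζ ξ hξ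
    rw [Finset.mem_filter] at hζ hξ
    obtain ⟨q, hq, hqM, hζq⟩ := hVmem ζ hζ.1
    obtain ⟨r, hr, hrM, hξr⟩ := hVmem ξ hξ.1
    by_contra hne
    have hξ0 : ξ ≠ 0 := hξr.ne_zero hr.ne'
    have hω1 : ζ / ξ ≠ 1 := by rwa [ne_eq, div_eq_one_iff_eq hξ0]
    have hωn : ‖ζ / ξ‖ = 1 := by rw [norm_div, hnorm _ hζ.1, hnorm _ hξ.1, div_one]
    have hpow : (ζ / ξ) ^ (q * r) = 1 := by
      rw [div_pow, pow_mul, hζq.pow_eq_one, mul_comm, pow_mul, hξr.pow_eq_one]; simp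
    have h1 := one_le_mul_norm_sub_one hωn hω1 (Nat.mul_pos hq hr) hpow
    have h2 : ‖ζ / ξ - 1‖ = ‖(ζ * w - 1) - (ξ * w - 1)‖ := by
      rw [div_sub_one hξ0, norm_div, hnorm _ hξ.1, div_one, sub_sub_sub_cancel_right, ← sub_mul,
        norm_mul, hw, mul_one]
    have h3 : ‖ζ / ξ - 1‖ ≤ ‖ζ * w - 1‖ + ‖ξ * w - 1‖ := h2 ▸ norm_sub_le _ _
    have h4 : ((q * r : ℕ) : ℝ) ≤ (M : ℝ) ^ 2 := by
      rw [pow_two]; exact_mod_cast Nat.mul_le_mul hqM hrM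
    have h5 : ((q * r : ℕ) : ℝ) * ‖ζ / ξ - 1‖ ≤ (M : ℝ) ^ 2 * (‖ζ * w - 1‖ + ‖ξ * w - 1‖) := by
      gcongr
    have h6 := hζ.2
    have h7 := hξ.2
    simp only [hP] at h6 h7
    linarith
  refine add_le_add ?_ ?_
  · calc ∑ ζ ∈ V.filter P, fejer n (ζ * w) ≤ #(V.filter P) • (n : ℝ) ^ 2 := by
          refine Finset.sum_le_card_nsmul _ _ _ fun ζ hζ => fejer_le_sq ?_ n
          rw [norm_mul, hw, hnorm _ (Finset.mem_filter.1 hζ).1, mul_one]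
      _ ≤ 1 • (n : ℝ) ^ 2 := by gcongr
      _ = _ := one_nsmul _
  · calc ∑ ζ ∈ V.filter (fun ζ => ¬ P ζ), fejer n (ζ * w)
        ≤ #(V.filter (fun ζ => ¬ P ζ)) • (16 * (M : ℝ) ^ 4) := by
          refine Finset.sum_le_card_nsmul _ _ _ fun ζ hζ => ?_
          rw [Finset.mem_filter] at hζ
          have h1 : ‖ζ * w‖ = 1 := by rw [norm_mul, hw, hnorm _ hζ.1, mul_one]
          have h2 := fejer_mul_le h1 n
          have h3 := hζ.2
          simp only [hP, not_lt] at h3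
          have h4 : 1 ≤ (‖ζ * w - 1‖ * (2 * (M : ℝ) ^ 2)) ^ 2 := one_le_pow₀ h3
          have h5 := mul_le_mul_of_nonneg_left h4 (fejer_nonneg n (ζ * w))
          have h6 := mul_le_mul_of_nonneg_right h2 (by positivity : 0 ≤ 4 * (M : ℝ) ^ 4)
          nlinarith
      _ ≤ (M ^ 2) • (16 * (M : ℝ) ^ 4) := by
          gcongr
          exact (Finset.card_filter_le _ _).trans hcard
      _ = _ := by rw [nsmul_eq_mul]; push_cast; ring

theorem sum_energy_ramanujanSum_le {ι : Type*} {s : Finset ι} {z : ι → ℂ}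
    (hz : ∀ i ∈ s, ‖z i‖ = 1) (n M : ℕ) :
    ∑ q ∈ Icc 1 M, energy s z n (fun x => ramanujanSum x q) ≤
      (#s : ℝ) ^ 2 * ((n : ℝ) ^ 2 + 16 * (M : ℝ) ^ 6) := by
  have h1 : ∀ q ∈ Icc 1 M, energy s z n (fun x => ramanujanSum x q) =
      ∑ i ∈ s, ∑ j ∈ s, ∑ ζ ∈ primitiveRoots q ℂ,
        fejer n (ζ * (z i * (starRingEnd ℂ) (z j))) := by
    intro q hq
    rw [energy_ramanujanSum hz (Finset.mem_Icc.1 hq).1, Finset.sum_comm]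
    exact Finset.sum_congr rfl fun i _ => Finset.sum_comm
  rw [Finset.sum_congr rfl h1, Finset.sum_comm]
  calc _ ≤ ∑ i ∈ s, ∑ j ∈ s, ((n : ℝ) ^ 2 + 16 * (M : ℝ) ^ 6) := by
        refine Finset.sum_le_sum fun i hi => ?_
        rw [Finset.sum_comm]
        refine Finset.sum_le_sum fun j hj => sum_fejer_primitiveRoots_le ?_ n M
        rw [norm_mul, RCLike.norm_conj, hz i hi, hz j hj, mul_one]
    _ = _ := by simp; ring

theorem succ_le_mul_rpow {ε : ℝ} (hε : 0 < ε) {p : ℕ} (hp : 2 ≤ p) (v : ℕ) :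
    (v + 1 : ℝ) ≤ (1 + 1 / (ε * Real.log 2)) * ((p : ℝ) ^ v) ^ ε := by
  have hl : 0 < Real.log 2 := Real.log_pos one_lt_two
  have h1 : 1 + ε * Real.log 2 * v ≤ ((p : ℝ) ^ v) ^ ε := by
    have h2 : ((2 : ℝ) ^ v) ^ ε ≤ ((p : ℝ) ^ v) ^ ε := by
      gcongr
      exact_mod_cast hp
    have h3 : ((2 : ℝ) ^ v) ^ ε = Real.exp (ε * Real.log 2 * v) := by
      rw [Real.rpow_def_of_pos (by positivity), Real.log_pow]; ring_nf
    have h4 := Real.add_one_le_exp (ε * Real.log 2 * v)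
    linarith
  refine le_trans ?_ (mul_le_mul_of_nonneg_left h1 (by positivity))
  have h5 : (1 + 1 / (ε * Real.log 2)) * (1 + ε * Real.log 2 * v) =
    1 + 1 / (ε * Real.log 2) + ε * Real.log 2 * v + v := by field_simp; ring
  rw [h5]
  have : 0 ≤ 1 / (ε * Real.log 2) := by positivity
  have : 0 ≤ ε * Real.log 2 * v := by positivity
  linarith

theorem succ_le_rpow {ε : ℝ} {p : ℕ} (hp : 2 ≤ (p : ℝ) ^ ε) (v : ℕ) :
    (v + 1 : ℝ) ≤ ((p : ℝ) ^ v) ^ ε := by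
  have h1 : ((p : ℝ) ^ v) ^ ε = ((p : ℝ) ^ ε) ^ v := by
    rw [← Real.rpow_natCast, ← Real.rpow_mul (by positivity), mul_comm, Real.rpow_mul (by positivity),
      Real.rpow_natCast]
  rw [h1]
  calc (v + 1 : ℝ) ≤ 2 ^ v := by exact_mod_cast Nat.lt_two_pow_self
    _ ≤ _ := by gcongr

/-- The divisor bound `d(n) ≪_ε n^ε`. -/
theorem exists_card_divisors_le {ε : ℝ} (hε : 0 < ε) :
    ∃ C : ℝ, 1 ≤ C ∧ ∀ n : ℕ, 0 < n → (#n.divisors : ℝ) ≤ C * (n : ℝ) ^ ε := by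
  set K : ℝ := 1 + 1 / (ε * Real.log 2) with hK
  have hl : 0 < Real.log 2 := Real.log_pos one_lt_two
  have hK1 : 1 ≤ K := by rw [hK]; have : 0 ≤ 1 / (ε * Real.log 2) := by positivity
                         linarith
  set B : ℕ := ⌈(2 : ℝ) ^ (1 / ε)⌉₊ with hB
  refine ⟨K ^ B, one_le_pow₀ hK1, fun n hn => ?_⟩
  have hprod : (n : ℝ) ^ ε = ∏ p ∈ n.primeFactors, ((p : ℝ) ^ (n.factorization p)) ^ ε := by
    rw [Real.finsetProd_rpow _ _ (fun i _ => by positivity)]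
    congr 1
    conv_lhs => rw [← Nat.prod_factorization_pow_eq_self hn.ne']
    rw [Finsupp.prod]
    push_cast
    rfl
  rw [Nat.card_divisors hn.ne', hprod]
  push_cast
  have hstep : ∀ p ∈ n.primeFactors, ((n.factorization p : ℝ) + 1) ≤
      (if p < B then K else 1) * ((p : ℝ) ^ (n.factorization p)) ^ ε := by
    intro p hp
    have hp2 := (Nat.prime_of_mem_primeFactors hp).two_le
    split_ifs with h
    · exact succ_le_mul_rpow hε hp2 _
    · rw [one_mul]
      refine succ_le_rpow ?_ _
      have h1 : (2 : ℝ) ^ (1 / ε) ≤ p := (Nat.le_ceil _).trans (by exact_mod_cast not_lt.1 h)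
      calc (2 : ℝ) = ((2 : ℝ) ^ (1 / ε)) ^ ε := by
            rw [← Real.rpow_mul (by norm_num), one_div_mul_cancel hε.ne', Real.rpow_one]
        _ ≤ _ := by gcongr
  refine (Finset.prod_le_prod (fun _ _ => by positivity) hstep).trans ?_
  rw [Finset.prod_mul_distrib]
  refine mul_le_mul_of_nonneg_right ?_ (Finset.prod_nonneg fun _ _ => by positivity)
  rw [← Finset.prod_filter, Finset.prod_const]
  refine pow_le_pow_right₀ hK1 ?_
  calc #(n.primeFactors.filter (· < B)) ≤ #(range B) := by
        refine Finset.card_le_card fun p hp => ?_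
        exact Finset.mem_range.2 (Finset.mem_filter.1 hp).2
    _ = B := Finset.card_range B

/-- The function `x ↦ Σ_{q ≤ Q, q ∣ x} d(q)²`. -/
noncomputable def divisorWeight (Q : ℕ) (x : ℤ) : ℝ :=
  ∑ q ∈ Icc 1 Q, (#q.divisors : ℝ) ^ 2 * if (q : ℤ) ∣ x then 1 else 0

theorem sum_sum_ite_dvd_le {m n : ℕ} (hm : 0 < m) (hmn : m ≤ n) :
    ∑ u ∈ range n, ∑ v ∈ range n, (if (m : ℤ) ∣ (u : ℤ) - v then (1 : ℝ) else 0) ≤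
      2 * (n : ℝ) ^ 2 / m := by
  have h1 : ∀ u ∈ range n, ∑ v ∈ range n, (if (m : ℤ) ∣ (u : ℤ) - v then (1 : ℝ) else 0) ≤
      2 * n / m := by
    intro u _
    rw [Finset.sum_boole]
    have h2 : (range n).filter (fun v : ℕ => (m : ℤ) ∣ (u : ℤ) - v) =
        (range n).filter (fun v => v ≡ u [MOD m]) := by
      refine Finset.filter_congr fun v _ => ?_
      rw [Nat.modEq_iff_dvd]
    rw [h2, ← Nat.count_eq_card_filter_range, Nat.count_modEq_card _ hm]
    have h3 : n / m + (if u % m < n % m then 1 else 0) ≤ n / m + 1 := by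
      split_ifs <;> omega
    calc ((n / m + (if u % m < n % m then 1 else 0) : ℕ) : ℝ) ≤ ((n / m + 1 : ℕ) : ℝ) := by
          exact_mod_cast h3
      _ ≤ (n : ℝ) / m + (n : ℝ) / m := by
          push_cast
          refine add_le_add Nat.cast_div_le ?_
          rw [one_le_div (by positivity)]
          exact_mod_cast hmn
      _ = _ := by ring
  calc _ ≤ ∑ u ∈ range n, (2 * n / m : ℝ) := Finset.sum_le_sum h1
    _ = _ := by simp; ring

theorem exists_sum_divisorWeight_pow_le (k : ℕ) (hk : 0 < k) :
    ∃ C : ℝ, 0 < C ∧ ∀ Q n : ℕ, 0 < Q → Q ^ k ≤ n →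
      ∑ u ∈ range n, ∑ v ∈ range n, divisorWeight Q ((u : ℤ) - v) ^ k ≤ C * (n : ℝ) ^ 2 * Q := by
  classical
  have hk' : (0 : ℝ) < k := by exact_mod_cast hk
  obtain ⟨C₀, hC₀, hdiv⟩ := exists_card_divisors_le (ε := 1 / (6 * k ^ 2 : ℝ)) (by positivity)
  have hsum : Summable (fun m : ℕ => 1 / (m : ℝ) ^ (1 + 1 / (2 * k : ℝ))) :=
    Real.summable_one_div_nat_rpow.2 (by have : 0 < 1 / (2 * k : ℝ) := by positivity
                                         linarith)
  set Z := ∑' m : ℕ, 1 / (m : ℝ) ^ (1 + 1 / (2 * k : ℝ)) with hZ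
  have hZ0 : 0 ≤ Z := tsum_nonneg fun m => by positivity
  refine ⟨2 * C₀ ^ (3 * k) * Z + 1, by positivity, fun Q n hQ hQn => ?_⟩
  set T := Fintype.piFinset (fun _ : Fin k => Icc 1 Q) with hT
  have hlcm_pos : ∀ f ∈ T, 0 < univ.lcm f := by
    intro f hf
    rw [Nat.pos_iff_ne_zero, ne_eq, Finset.lcm_eq_zero_iff]
    rintro ⟨i, -, hi⟩
    have := Fintype.mem_piFinset.1 hf i
    rw [Finset.mem_Icc] at this
    omega
  have hlcm_le : ∀ f ∈ T, univ.lcm f ≤ Q ^ k := by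
    intro f hf
    have h1 : univ.lcm f ∣ ∏ i, f i := Finset.lcm_dvd fun i _ => Finset.dvd_prod_of_mem f (mem_univ i)
    have h2 : 0 < ∏ i, f i := Finset.prod_pos fun i _ =>
      (Finset.mem_Icc.1 (Fintype.mem_piFinset.1 hf i)).1
    refine (Nat.le_of_dvd h2 h1).trans ?_
    calc ∏ i, f i ≤ ∏ _i : Fin k, Q := Finset.prod_le_prod' fun i _ =>
          (Finset.mem_Icc.1 (Fintype.mem_piFinset.1 hf i)).2
      _ = Q ^ k := by simp
  have hpow : ∀ x : ℤ, divisorWeight Q x ^ k ≤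
      ∑ f ∈ T, (#(univ.lcm f).divisors : ℝ) ^ (2 * k) *
        (if ((univ.lcm f : ℕ) : ℤ) ∣ x then 1 else 0) := by
    intro x
    have h1 : divisorWeight Q x ^ k = ∑ f ∈ T, ∏ i, ((#(f i).divisors : ℝ) ^ 2 *
        if ((f i : ℕ) : ℤ) ∣ x then 1 else 0) := by
      rw [divisorWeight, hT, ← Finset.prod_univ_sum (fun _ : Fin k => Icc 1 Q)
        (fun _ q => (#q.divisors : ℝ) ^ 2 * if (q : ℤ) ∣ x then 1 else 0)]
      simp
    rw [h1]
    refine Finset.sum_le_sum fun f hf => ?_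
    rw [Finset.prod_mul_distrib]
    have h2 : (∏ i, (if ((f i : ℕ) : ℤ) ∣ x then (1 : ℝ) else 0)) =
        if ((univ.lcm f : ℕ) : ℤ) ∣ x then 1 else 0 := by
      have h3 : ((univ.lcm f : ℕ) : ℤ) ∣ x ↔ ∀ i, ((f i : ℕ) : ℤ) ∣ x := by
        simp only [Int.natCast_dvd, Finset.lcm_dvd_iff, mem_univ, true_implies]
      by_cases h : ∀ i, ((f i : ℕ) : ℤ) ∣ x
      · rw [if_pos (h3.2 h)]
        exact Finset.prod_eq_one fun i _ => if_pos (h i)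
      · rw [if_neg (fun h' => h (h3.1 h'))]
        push Not at h
        obtain ⟨i, hi⟩ := h
        exact Finset.prod_eq_zero (mem_univ i) (if_neg hi)
    rw [h2]
    refine mul_le_mul_of_nonneg_right ?_ (by split_ifs <;> norm_num)
    calc ∏ i, (#(f i).divisors : ℝ) ^ 2 ≤ ∏ _i : Fin k, (#(univ.lcm f).divisors : ℝ) ^ 2 := by
          refine Finset.prod_le_prod (fun _ _ => by positivity) fun i _ => ?_
          gcongr
          · exact (hlcm_pos f hf).ne'
          · exact Finset.dvd_lcm (mem_univ i)
      _ = _ := by simp [pow_mul]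
  have hfib : ∀ m ∈ Icc 1 (Q ^ k), #(T.filter (fun f => univ.lcm f = m)) ≤ #m.divisors ^ k := by
    intro m hm
    rw [Finset.mem_Icc] at hm
    calc _ ≤ #(Fintype.piFinset (fun _ : Fin k => m.divisors)) := by
          refine Finset.card_le_card fun f hf => ?_
          rw [Finset.mem_filter] at hf
          refine Fintype.mem_piFinset.2 fun i => Nat.mem_divisors.2 ⟨?_, by omega⟩
          rw [← hf.2]
          exact Finset.dvd_lcm (mem_univ i)
      _ = _ := by simp
  have hQ1 : (1 : ℝ) ≤ Q := by exact_mod_cast hQ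
  have hterm : ∀ m ∈ Icc 1 (Q ^ k), (#m.divisors : ℝ) ^ (3 * k) / m ≤
      C₀ ^ (3 * k) * Q * (1 / (m : ℝ) ^ (1 + 1 / (2 * k : ℝ))) := by
    intro m hm
    rw [Finset.mem_Icc] at hm
    have hm0 : (0 : ℝ) < m := by exact_mod_cast hm.1
    have h1 : (#m.divisors : ℝ) ^ (3 * k) ≤ C₀ ^ (3 * k) * (m : ℝ) ^ (1 / (2 * k : ℝ)) := by
      calc (#m.divisors : ℝ) ^ (3 * k) ≤ (C₀ * (m : ℝ) ^ (1 / (6 * k ^ 2 : ℝ))) ^ (3 * k) := by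
            gcongr; exact hdiv m hm.1
        _ = _ := by
            rw [mul_pow, ← Real.rpow_natCast ((m : ℝ) ^ (1 / (6 * k ^ 2 : ℝ))), ← Real.rpow_mul hm0.le]
            congr 2
            push_cast
            field_simp
            norm_num
    have h2 : (m : ℝ) ^ (1 / (2 * k : ℝ)) * (m : ℝ) ^ (1 / (2 * k : ℝ)) ≤ Q := by
      rw [← Real.rpow_add hm0]
      calc (m : ℝ) ^ (1 / (2 * k : ℝ) + 1 / (2 * k : ℝ)) ≤
            ((Q : ℝ) ^ k) ^ (1 / (2 * k : ℝ) + 1 / (2 * k : ℝ)) := by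
            gcongr
            exact_mod_cast hm.2
        _ = Q := by
            rw [← Real.rpow_natCast, ← Real.rpow_mul (by positivity)]
            convert Real.rpow_one (Q : ℝ) using 2
            field_simp
            norm_num
    rw [Real.rpow_add hm0, Real.rpow_one]
    have h3 : 0 < (m : ℝ) ^ (1 / (2 * k : ℝ)) := by positivity
    rw [div_le_iff₀ hm0]
    calc _ ≤ C₀ ^ (3 * k) * (m : ℝ) ^ (1 / (2 * k : ℝ)) := h1
      _ ≤ C₀ ^ (3 * k) * (Q / (m : ℝ) ^ (1 / (2 * k : ℝ))) := by
          gcongr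
          rwa [le_div_iff₀ h3]
      _ = _ := by field_simp
  calc ∑ u ∈ range n, ∑ v ∈ range n, divisorWeight Q ((u : ℤ) - v) ^ k
      ≤ ∑ u ∈ range n, ∑ v ∈ range n, ∑ f ∈ T, (#(univ.lcm f).divisors : ℝ) ^ (2 * k) *
        (if ((univ.lcm f : ℕ) : ℤ) ∣ (u : ℤ) - v then 1 else 0) :=
        Finset.sum_le_sum fun u _ => Finset.sum_le_sum fun v _ => hpow _
    _ = ∑ f ∈ T, (#(univ.lcm f).divisors : ℝ) ^ (2 * k) * ∑ u ∈ range n, ∑ v ∈ range n,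
        (if ((univ.lcm f : ℕ) : ℤ) ∣ (u : ℤ) - v then (1 : ℝ) else 0) := by
        simp only [Finset.sum_comm (s := range n) (t := T), Finset.mul_sum]
    _ ≤ ∑ f ∈ T, (#(univ.lcm f).divisors : ℝ) ^ (2 * k) * (2 * (n : ℝ) ^ 2 / (univ.lcm f : ℕ)) := by
        refine Finset.sum_le_sum fun f hf => ?_
        gcongr
        exact sum_sum_ite_dvd_le (hlcm_pos f hf) ((hlcm_le f hf).trans hQn)
    _ = ∑ m ∈ Icc 1 (Q ^ k), ∑ f ∈ T.filter (fun f => univ.lcm f = m),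
        (#(univ.lcm f).divisors : ℝ) ^ (2 * k) * (2 * (n : ℝ) ^ 2 / (univ.lcm f : ℕ)) :=
        (Finset.sum_fiberwise_of_maps_to (fun f hf => Finset.mem_Icc.2
          ⟨hlcm_pos f hf, hlcm_le f hf⟩) _).symm
    _ ≤ ∑ m ∈ Icc 1 (Q ^ k), 2 * (n : ℝ) ^ 2 * ((#m.divisors : ℝ) ^ (3 * k) / m) := by
        refine Finset.sum_le_sum fun m hm => ?_
        rw [Finset.sum_congr rfl (fun f hf => by rw [(Finset.mem_filter.1 hf).2]),
          Finset.sum_const, nsmul_eq_mul]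
        calc _ ≤ ((#m.divisors ^ k : ℕ) : ℝ) *
              ((#m.divisors : ℝ) ^ (2 * k) * (2 * (n : ℝ) ^ 2 / m)) := by
              gcongr
              exact_mod_cast hfib m hm
          _ = _ := by
              push_cast
              have : 3 * k = k + 2 * k := by ring
              rw [this, pow_add]
              ring
    _ ≤ ∑ m ∈ Icc 1 (Q ^ k), 2 * (n : ℝ) ^ 2 *
          (C₀ ^ (3 * k) * Q * (1 / (m : ℝ) ^ (1 + 1 / (2 * k : ℝ)))) := by
        refine Finset.sum_le_sum fun m hm => ?_
        gcongr
        exact hterm m hm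
    _ = 2 * (n : ℝ) ^ 2 * (C₀ ^ (3 * k) * Q) *
          ∑ m ∈ Icc 1 (Q ^ k), (1 / (m : ℝ) ^ (1 + 1 / (2 * k : ℝ))) := by
        rw [Finset.mul_sum]
        exact Finset.sum_congr rfl fun _ _ => by ring
    _ ≤ 2 * (n : ℝ) ^ 2 * (C₀ ^ (3 * k) * Q) * Z := by
        gcongr
        exact hsum.sum_le_tsum _ fun m _ => by positivity
    _ ≤ (2 * C₀ ^ (3 * k) * Z + 1) * (n : ℝ) ^ 2 * Q := by
        have : 0 ≤ (n : ℝ) ^ 2 * Q := by positivity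
        linarith

section LevelSet

variable {ι : Type*} {s : Finset ι} {z : ι → ℂ} {n : ℕ}

/-- The sum `Σ_{q ≤ M} (d(q)²/q) Ψ(c_q)`, where `Ψ` is the energy functional. -/
noncomputable def weightedEnergy (s : Finset ι) (z : ι → ℂ) (n M : ℕ) : ℝ :=
  ∑ q ∈ Icc 1 M, (#q.divisors ^ 2 * (q : ℝ)⁻¹) * energy s z n (fun x => ramanujanSum x q)

theorem energy_ramanujanSum_le (hz : ∀ i ∈ s, ‖z i‖ = 1) {q : ℕ} (hq : 0 < q) :
    (q : ℝ)⁻¹ * energy s z n (fun x => ramanujanSum x q) ≤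
      energy s z n (fun x => if (q : ℤ) ∣ x then 1 else 0) := by
  have h1 : energy s z n (fun x => ramanujanSum x q) ≤
      ∑ d ∈ q.divisors, energy s z n (fun x => ramanujanSum x d) :=
    Finset.single_le_sum (f := fun d => energy s z n (fun x => ramanujanSum x d))
      (fun d hd => energy_ramanujanSum_nonneg hz (Nat.pos_of_mem_divisors hd))
      (Nat.mem_divisors_self q hq.ne')
  rw [← energy_sum] at h1
  simp only [sum_divisors_ramanujanSum] at h1
  refine (mul_le_mul_of_nonneg_left h1 (by positivity)).trans (le_of_eq ?_)
  rw [← energy_const_mul]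
  congr 1
  ext x
  have : (q : ℝ) ≠ 0 := by positivity
  split_ifs <;> simp [this]

theorem exists_weightedEnergy_le :
    ∃ C : ℝ, 0 < C ∧ ∀ {ι : Type} (s : Finset ι) (z : ι → ℂ) (n M : ℕ),
      (∀ i ∈ s, ‖z i‖ = 1) →
      weightedEnergy s z n M ≤ C * ((#s : ℝ) ^ 2 * ((n : ℝ) ^ 2 + 16 * (M : ℝ) ^ 6)) ∧
      ∀ Q : ℕ, 0 < Q → weightedEnergy s z n M ≤ energy s z n (divisorWeight Q) +
        C * (Q : ℝ) ^ (-(1 / 2) : ℝ) * ((#s : ℝ) ^ 2 * ((n : ℝ) ^ 2 + 16 * (M : ℝ) ^ 6)) := by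
  obtain ⟨C, hC, hdiv⟩ := exists_card_divisors_le (ε := 1 / 4) (by norm_num)
  have hd : ∀ q : ℕ, 0 < q → (#q.divisors ^ 2 * (q : ℝ)⁻¹) ≤ C ^ 2 * (q : ℝ) ^ (-(1 / 2) : ℝ) := by
    intro q hq
    have hq0 : (0 : ℝ) < q := by exact_mod_cast hq
    calc (#q.divisors ^ 2 * (q : ℝ)⁻¹) ≤ (C * (q : ℝ) ^ (1 / 4 : ℝ)) ^ 2 * (q : ℝ)⁻¹ := by
          gcongr; exact hdiv q hq
      _ = _ := by
          rw [mul_pow, ← Real.rpow_natCast ((q : ℝ) ^ (1 / 4 : ℝ)), ← Real.rpow_mul hq0.le, mul_assoc,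
            ← Real.rpow_neg_one, ← Real.rpow_add hq0]
          norm_num
  refine ⟨C ^ 2, by positivity, fun s z n M hz => ⟨?_, fun Q hQ => ?_⟩⟩
  · refine le_trans ?_ (mul_le_mul_of_nonneg_left (sum_energy_ramanujanSum_le hz n M)
      (by positivity))
    rw [Finset.mul_sum]
    refine Finset.sum_le_sum fun q hq => ?_
    have hq1 := (Finset.mem_Icc.1 hq).1
    refine mul_le_mul_of_nonneg_right ?_ (energy_ramanujanSum_nonneg hz hq1)
    refine (hd q hq1).trans (mul_le_of_le_one_right (by positivity) ?_)
    exact Real.rpow_le_one_of_one_le_of_nonpos (by exact_mod_cast hq1) (by norm_num)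
  · rw [weightedEnergy, ← Finset.sum_filter_add_sum_filter_not (Icc 1 M) (fun q => q ≤ Q)]
    refine add_le_add ?_ ?_
    · have : energy s z n (divisorWeight Q) = ∑ q ∈ Icc 1 Q, (#q.divisors : ℝ) ^ 2 *
          energy s z n (fun x => if (q : ℤ) ∣ x then 1 else 0) := by
        simp only [← energy_const_mul, ← energy_sum]
        rfl
      rw [this]
      have hsub : (Icc 1 M).filter (fun q => q ≤ Q) ⊆ Icc 1 Q := by
        intro q hq
        simp only [Finset.mem_filter, Finset.mem_Icc] at hq ⊢
        omega
      have hle : ∀ q ∈ Icc 1 Q, (#q.divisors ^ 2 * (q : ℝ)⁻¹) *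
          energy s z n (fun x => ramanujanSum x q) ≤ (#q.divisors : ℝ) ^ 2 *
          energy s z n (fun x => if (q : ℤ) ∣ x then 1 else 0) := by
        intro q hq
        rw [mul_assoc]
        gcongr
        exact energy_ramanujanSum_le hz (Finset.mem_Icc.1 hq).1
      refine le_trans ?_ (Finset.sum_le_sum hle)
      refine Finset.sum_le_sum_of_subset_of_nonneg hsub fun q hq _ => ?_
      have := energy_ramanujanSum_nonneg (n := n) hz (Finset.mem_Icc.1 hq).1
      positivity
    · refine le_trans ?_ (mul_le_mul_of_nonneg_left (sum_energy_ramanujanSum_le hz n M)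
        (by positivity))
      rw [Finset.mul_sum]
      refine le_trans (Finset.sum_le_sum fun q hq => ?_)
        (Finset.sum_le_sum_of_subset_of_nonneg (Finset.filter_subset _ _) fun q hq _ => ?_)
      · rw [Finset.mem_filter, Finset.mem_Icc, not_le] at hq
        refine mul_le_mul_of_nonneg_right ?_ (energy_ramanujanSum_nonneg hz hq.1.1)
        refine (hd q hq.1.1).trans (mul_le_mul_of_nonneg_left ?_ (by positivity))
        exact Real.rpow_le_rpow_of_nonpos (by exact_mod_cast hQ) (by exact_mod_cast hq.2.le)
          (by norm_num)
      · have := energy_ramanujanSum_nonneg (n := n) hz (Finset.mem_Icc.1 hq).1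
        positivity

theorem sum_norm_sq_of_roots {N : ℕ} (hN : 0 < N) (hroot : ∀ i ∈ s, z i ^ N = 1)
    (hinj : Set.InjOn z s) :
    ∑ u ∈ range (2 * N), ∑ v ∈ range (2 * N), ‖∑ i ∈ s, z i ^ ((u : ℤ) - v)‖ ^ 2 =
      4 * (N : ℝ) ^ 2 * #s := by
  classical
  have hz : ∀ i ∈ s, ‖z i‖ = 1 := fun i hi => Complex.norm_eq_one_of_pow_eq_one (hroot i hi) hN.ne'
  have h := sum_norm_sq s (fun _ => 1) z hz (2 * N)
  simp only [one_mul, map_one] at h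
  apply Complex.ofReal_injective
  rw [h]
  have h2 : ∀ i ∈ s, ∀ j ∈ s, fejer (2 * N) (z i * (starRingEnd ℂ) (z j)) =
      if i = j then 4 * (N : ℝ) ^ 2 else 0 := by
    intro i hi j hj
    have hj0 : z j ≠ 0 := by intro h0; simpa [h0] using hz j hj
    rw [← Complex.inv_eq_conj (hz j hj)]
    split_ifs with hij
    · rw [hij, mul_inv_cancel₀ hj0, fejer]
      simp only [one_pow, sum_const, card_range, nsmul_eq_mul, mul_one, Complex.norm_natCast]
      push_cast
      ring
    · have hne : z i * (z j)⁻¹ ≠ 1 := by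
        rw [ne_eq, mul_inv_eq_one₀ hj0]
        exact fun h' => hij (hinj hi hj h')
      rw [fejer, geom_sum_eq hne, mul_comm 2 N, pow_mul, mul_pow, inv_pow, hroot i hi, hroot j hj]
      simp
  calc ∑ i ∈ s, ∑ j ∈ s, ((fejer (2 * N) (z i * (starRingEnd ℂ) (z j)) : ℝ) : ℂ)
      = ∑ i ∈ s, ∑ j ∈ s, (((if i = j then 4 * (N : ℝ) ^ 2 else 0 : ℝ)) : ℂ) :=
        Finset.sum_congr rfl fun i hi => Finset.sum_congr rfl fun j hj => by rw [h2 i hi j hj]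
    _ = _ := by
        rw [← Complex.ofReal_inj.2 (show (∑ i ∈ s, ∑ j ∈ s, (if i = j then 4 * (N : ℝ) ^ 2 else 0)) =
          4 * (N : ℝ) ^ 2 * #s by simp; ring)]
        push_cast
        rfl

theorem divisorWeight_nonneg (Q : ℕ) (x : ℤ) : 0 ≤ divisorWeight Q x :=
  Finset.sum_nonneg fun q _ => by split_ifs <;> positivity

theorem energy_divisorWeight_le (hz : ∀ i ∈ s, ‖z i‖ = 1) {τ : ℝ} (hτ : 0 < τ) (Q k : ℕ) :
    energy s z n (divisorWeight Q) ≤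
      τ * ∑ u ∈ range n, ∑ v ∈ range n, ‖∑ i ∈ s, z i ^ ((u : ℤ) - v)‖ ^ 2 +
      (#s : ℝ) ^ 2 / τ ^ k *
        ∑ u ∈ range n, ∑ v ∈ range n, divisorWeight Q ((u : ℤ) - v) ^ (k + 1) := by
  simp only [energy, Finset.mul_sum, ← Finset.sum_add_distrib]
  refine Finset.sum_le_sum fun u _ => Finset.sum_le_sum fun v _ => ?_
  set g := divisorWeight Q ((u : ℤ) - v)
  have hg : 0 ≤ g := divisorWeight_nonneg _ _
  have hS : ‖∑ i ∈ s, z i ^ ((u : ℤ) - v)‖ ^ 2 ≤ (#s : ℝ) ^ 2 := by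
    gcongr
    refine (norm_sum_le _ _).trans (le_of_eq ?_)
    rw [Finset.sum_congr rfl (fun i hi => by rw [norm_zpow, hz i hi, one_zpow])]
    simp
  rcases le_total g τ with h | h
  · have h1 : 0 ≤ (#s : ℝ) ^ 2 / τ ^ k * g ^ (k + 1) := by positivity
    have h2 := mul_le_mul_of_nonneg_right h (sq_nonneg ‖∑ i ∈ s, z i ^ ((u : ℤ) - v)‖)
    linarith
  · have h1 : g ≤ g ^ (k + 1) / τ ^ k := by
      rw [le_div_iff₀ (by positivity), pow_succ']
      gcongr
    have h2 : g * ‖∑ i ∈ s, z i ^ ((u : ℤ) - v)‖ ^ 2 ≤ g ^ (k + 1) / τ ^ k * (#s : ℝ) ^ 2 := by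
      gcongr
    have h3 : 0 ≤ τ * ‖∑ i ∈ s, z i ^ ((u : ℤ) - v)‖ ^ 2 := by positivity
    calc _ ≤ _ := h2
      _ = 0 + (#s : ℝ) ^ 2 / τ ^ k * g ^ (k + 1) := by ring
      _ ≤ _ := by gcongr

/-- The large values estimate deduced from a bound by the weighted energy. -/
theorem exists_card_le_of_weightedEnergy {C₁ η : ℝ} (hC₁ : 0 < C₁) (hη : 0 < η) :
    ∃ C K : ℝ, ∃ k : ℕ, 0 < C ∧ 0 < K ∧ ∀ {ι : Type} (s : Finset ι) (z : ι → ℂ) (N M : ℕ) (δ : ℝ),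
      0 < N → (∀ i ∈ s, z i ^ N = 1) → Set.InjOn z s → M ^ 6 ≤ N ^ 2 → 0 < δ →
      (#s : ℝ) ^ 2 * δ ^ 2 * (N : ℝ) ^ 2 ≤ C₁ * weightedEnergy s z (2 * N) M →
      (s.Nonempty → δ ≤ C) ∧
      (δ ≤ 1 → (K * (δ ^ 4)⁻¹) ^ (k + 1) ≤ N → (#s : ℝ) ≤ C * ((δ ^ 2)⁻¹ * δ ^ (-η))) := by
  obtain ⟨C₂, hC₂, hE⟩ := exists_weightedEnergy_le
  obtain ⟨k, hk⟩ := exists_nat_ge (6 / η + 1)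
  have hkη : 6 ≤ k * η := by
    have : 6 / η ≤ k := by linarith
    rwa [div_le_iff₀ hη] at this
  have hk1 : k ≠ 0 := by rintro rfl; simp at hkη; linarith
  obtain ⟨C₃, hC₃, hmom⟩ := exists_sum_divisorWeight_pow_le (k + 1) (Nat.succ_pos k)
  set K₀ := (80 * C₁ * C₂) ^ 2 with hK₀
  have hK₀pos : 0 < K₀ := by positivity
  set B := 1 + 16 * C₁ * C₃ * (K₀ + 1) with hB
  have hB1 : 1 ≤ B := by rw [hB]; have : 0 ≤ 16 * C₁ * C₃ * (K₀ + 1) := by positivity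
                         linarith
  refine ⟨8 * C₁ * B + (1 + 20 * C₁ * C₂), K₀ + 1, k, by positivity, by positivity, ?_⟩
  intro ι s z N M δ hN hroot hinj hMN hδ hmain
  have hN0 : (0 : ℝ) < N := by exact_mod_cast hN
  have hz : ∀ i ∈ s, ‖z i‖ = 1 := fun i hi => Complex.norm_eq_one_of_pow_eq_one (hroot i hi) hN.ne'
  obtain ⟨hE1, hE2⟩ := hE s z (2 * N) M hz
  have hMN' : (M : ℝ) ^ 6 ≤ (N : ℝ) ^ 2 := by exact_mod_cast hMN
  have h20 : (((2 * N : ℕ) : ℝ) ^ 2 + 16 * (M : ℝ) ^ 6) ≤ 20 * (N : ℝ) ^ 2 := by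
    push_cast; nlinarith
  have hBpos : 0 < 8 * C₁ * B := by positivity
  constructor
  · intro hs
    have hs0 : (0 : ℝ) < #s := by exact_mod_cast hs.card_pos
    have h1 : (#s : ℝ) ^ 2 * δ ^ 2 * (N : ℝ) ^ 2 ≤
        C₁ * (C₂ * ((#s : ℝ) ^ 2 * (20 * (N : ℝ) ^ 2))) := by
      refine hmain.trans ?_
      gcongr
      refine hE1.trans ?_
      gcongr
    have h2 : δ ^ 2 ≤ 20 * C₁ * C₂ := by
      have h3 : ((#s : ℝ) ^ 2 * (N : ℝ) ^ 2) * δ ^ 2 ≤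
        ((#s : ℝ) ^ 2 * (N : ℝ) ^ 2) * (20 * C₁ * C₂) := by linarith
      exact le_of_mul_le_mul_left h3 (by positivity)
    nlinarith [sq_nonneg (δ - 1)]
  · intro hδ1 hbig
    rcases s.eq_empty_or_nonempty with rfl | hs
    · simp only [card_empty, Nat.cast_zero]; positivity
    have hs0 : (0 : ℝ) < #s := by exact_mod_cast hs.card_pos
    have hδ4 : 1 ≤ (δ ^ 4)⁻¹ := (one_le_inv₀ (by positivity)).2 (pow_le_one₀ hδ.le hδ1)
    set Q := ⌈K₀ * (δ ^ 4)⁻¹⌉₊ with hQ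
    have hQpos : 0 < Q := Nat.ceil_pos.2 (by positivity)
    have hQ0 : (0 : ℝ) < Q := by exact_mod_cast hQpos
    have hQlow : K₀ * (δ ^ 4)⁻¹ ≤ Q := Nat.le_ceil _
    have hQup : (Q : ℝ) ≤ (K₀ + 1) * (δ ^ 4)⁻¹ := by
      have := (Nat.ceil_lt_add_one (by positivity : 0 ≤ K₀ * (δ ^ 4)⁻¹)).le
      linarith
    have hQN : Q ^ (k + 1) ≤ 2 * N := by
      have : (Q : ℝ) ^ (k + 1) ≤ N := (by gcongr : (Q : ℝ) ^ (k + 1) ≤ _).trans hbig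
      have : Q ^ (k + 1) ≤ N := by exact_mod_cast this
      omega
    have hQhalf : C₁ * (C₂ * (Q : ℝ) ^ (-(1 / 2) : ℝ) * 20) ≤ δ ^ 2 / 4 := by
      have h1 : 80 * C₁ * C₂ * (δ ^ 2)⁻¹ ≤ (Q : ℝ) ^ (1 / 2 : ℝ) := by
        rw [← Real.sqrt_eq_rpow]
        refine Real.le_sqrt_of_sq_le (le_trans (le_of_eq ?_) hQlow)
        rw [hK₀]; ring
      rw [Real.rpow_neg hQ0.le]
      have h2 : 0 < (Q : ℝ) ^ (1 / 2 : ℝ) := by positivity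
      have h3 : 80 * C₁ * C₂ ≤ (Q : ℝ) ^ (1 / 2 : ℝ) * δ ^ 2 := by
        rwa [← div_eq_mul_inv, div_le_iff₀ (by positivity)] at h1
      rw [show C₁ * (C₂ * ((Q : ℝ) ^ (1 / 2 : ℝ))⁻¹ * 20) =
        (20 * C₁ * C₂) / (Q : ℝ) ^ (1 / 2 : ℝ) by ring, div_le_iff₀ h2]
      linarith
    set τ := B * δ ^ (-η) with hτ
    have hτpos : 0 < τ := by positivity
    have hτk : 16 * C₁ * C₃ * (K₀ + 1) * (δ ^ 6)⁻¹ ≤ τ ^ k := by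
      rw [hτ, mul_pow]
      have h1 : 16 * C₁ * C₃ * (K₀ + 1) ≤ B ^ k :=
        (by rw [hB]; linarith : 16 * C₁ * C₃ * (K₀ + 1) ≤ B).trans (le_self_pow₀ hB1 hk1)
      have h2 : (δ ^ 6)⁻¹ ≤ (δ ^ (-η)) ^ k := by
        rw [← Real.rpow_natCast (δ ^ (-η)), ← Real.rpow_mul hδ.le, ← Real.rpow_natCast δ,
          ← Real.rpow_neg hδ.le]
        refine Real.rpow_le_rpow_of_exponent_ge hδ hδ1 ?_
        push_cast
        linarith
      gcongr
    have hmom' := hmom Q (2 * N) hQpos hQN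
    have hg := energy_divisorWeight_le (n := 2 * N) hz hτpos Q k
    rw [sum_norm_sq_of_roots hN hroot hinj] at hg
    have hpart : C₁ * ((#s : ℝ) ^ 2 / τ ^ k * (C₃ * ((2 * N : ℕ) : ℝ) ^ 2 * Q)) ≤
        (#s : ℝ) ^ 2 * (N : ℝ) ^ 2 * (δ ^ 2 / 4) := by
      calc _ ≤ C₁ * ((#s : ℝ) ^ 2 / τ ^ k * (C₃ * ((2 * N : ℕ) : ℝ) ^ 2 *
            ((K₀ + 1) * (δ ^ 4)⁻¹))) := by gcongr
        _ = (#s : ℝ) ^ 2 * (N : ℝ) ^ 2 * (4 * C₁ * C₃ * (K₀ + 1) * (δ ^ 4)⁻¹ / τ ^ k) := by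
            push_cast; ring
        _ ≤ _ := by
            refine mul_le_mul_of_nonneg_left ?_ (by positivity)
            rw [div_le_iff₀ (by positivity)]
            calc 4 * C₁ * C₃ * (K₀ + 1) * (δ ^ 4)⁻¹ =
                δ ^ 2 / 4 * (16 * C₁ * C₃ * (K₀ + 1) * (δ ^ 6)⁻¹) := by
                  field_simp; norm_num
              _ ≤ _ := by gcongr
    have htail : C₁ * (C₂ * (Q : ℝ) ^ (-(1 / 2) : ℝ) * ((#s : ℝ) ^ 2 *
        (((2 * N : ℕ) : ℝ) ^ 2 + 16 * (M : ℝ) ^ 6))) ≤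
        (#s : ℝ) ^ 2 * (N : ℝ) ^ 2 * (δ ^ 2 / 4) := by
      calc _ ≤ C₁ * (C₂ * (Q : ℝ) ^ (-(1 / 2) : ℝ) * ((#s : ℝ) ^ 2 * (20 * (N : ℝ) ^ 2))) := by
            gcongr
        _ = (#s : ℝ) ^ 2 * (N : ℝ) ^ 2 * (C₁ * (C₂ * (Q : ℝ) ^ (-(1 / 2) : ℝ) * 20)) := by ring
        _ ≤ _ := by gcongr
    have htot : (#s : ℝ) ^ 2 * δ ^ 2 * (N : ℝ) ^ 2 ≤ C₁ * (τ * (4 * (N : ℝ) ^ 2 * #s)) +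
        (#s : ℝ) ^ 2 * (N : ℝ) ^ 2 * (δ ^ 2 / 4) + (#s : ℝ) ^ 2 * (N : ℝ) ^ 2 * (δ ^ 2 / 4) := by
      have h1 := mul_le_mul_of_nonneg_left ((hE2 Q hQpos).trans (add_le_add_left hg _)) hC₁.le
      have h2 : C₁ * ((#s : ℝ) ^ 2 / τ ^ k * ∑ u ∈ range (2 * N), ∑ v ∈ range (2 * N),
          divisorWeight Q ((u : ℤ) - v) ^ (k + 1)) ≤
          C₁ * ((#s : ℝ) ^ 2 / τ ^ k * (C₃ * ((2 * N : ℕ) : ℝ) ^ 2 * Q)) := by gcongr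
      simp only [mul_add] at h1
      linarith
    have h1 : ((#s : ℝ) * (N : ℝ) ^ 2) * (#s * δ ^ 2) ≤
        ((#s : ℝ) * (N : ℝ) ^ 2) * (8 * C₁ * τ) := by nlinarith
    have h2 := le_of_mul_le_mul_left h1 (by positivity)
    calc (#s : ℝ) ≤ 8 * C₁ * τ * (δ ^ 2)⁻¹ := by
          rwa [← div_eq_mul_inv, le_div_iff₀ (by positivity)]
      _ = 8 * C₁ * B * ((δ ^ 2)⁻¹ * δ ^ (-η)) := by rw [hτ]; ring
      _ ≤ _ := by
          gcongr
          have : 0 < C₁ * C₂ := by positivity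
          linarith

end LevelSet

section Majorant

variable {ι : Type*} {s : Finset ι} {z : ι → ℂ} {n : ℕ}

/-- The squarefree integers up to `R` that are coprime to `W`. -/
def sieveSet (W R : ℕ) : Finset ℕ :=
  (Icc 1 R).filter fun q => Squarefree q ∧ W.Coprime q

theorem sum_norm_sq_moebius_le (hz : ∀ i ∈ s, ‖z i‖ = 1) {γ : ι → ℂ} (hγ : ∀ i ∈ s, ‖γ i‖ ≤ 1)
    (b : ℤ) (W R : ℕ) :
    ∑ u ∈ range n, ∑ v ∈ range n,
      ‖((∑ q ∈ sieveSet W R, (q : ℝ)⁻¹ * (ArithmeticFunction.moebius q *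
        ramanujanSum (W * ((u : ℤ) - v) + b) q) : ℝ) : ℂ) *
        ∑ i ∈ s, γ i * z i ^ ((u : ℤ) - v)‖ ^ 2 ≤
      energy s z n (fun x => ramanujanWeight (sieveSet W R) x ^ 2) := by
  have hpos : ∀ q ∈ sieveSet W R, 0 < q := fun q hq => (mem_Icc.1 (mem_filter.1 hq).1).1
  have hcop : ∀ q ∈ sieveSet W R, IsCoprime (W : ℤ) (q : ℤ) := fun q hq =>
    Nat.isCoprime_iff_coprime.2 (mem_filter.1 hq).2.2
  set t := ((sieveSet W R).sigma fun q => primitiveRoots q ℂ) ×ˢ s with ht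
  have hmem : ∀ p ∈ t, p.1.1 ∈ sieveSet W R ∧ ‖p.1.2‖ = 1 ∧ p.2 ∈ s := by
    intro p hp
    simp only [ht, mem_product, mem_sigma] at hp
    exact ⟨hp.1.1, norm_of_mem_primitiveRoots (hpos _ hp.1.1) hp.1.2, hp.2⟩
  have key := sum_norm_sq_le_of_norm_le t
    (fun p => (p.1.1 : ℂ)⁻¹ * ((ArithmeticFunction.moebius p.1.1 : ℂ) * p.1.2 ^ b) * γ p.2)
    (fun p => p.1.2 ^ (W : ℤ) * z p.2) (fun p => (p.1.1 : ℝ)⁻¹)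
    (fun p hp => by
      obtain ⟨-, h2, h3⟩ := hmem p hp
      rw [norm_mul, norm_zpow, h2, hz _ h3, one_zpow, one_mul])
    (fun p hp => by
      obtain ⟨h1, h2, h3⟩ := hmem p hp
      rw [norm_mul, norm_mul, norm_mul, norm_zpow, h2, one_zpow, mul_one, norm_inv,
        Complex.norm_natCast]
      have h4 : ‖(ArithmeticFunction.moebius p.1.1 : ℂ)‖ ≤ 1 := by
        rw [Complex.norm_intCast]
        exact_mod_cast ArithmeticFunction.abs_moebius_le_one
      have h5 : (0 : ℝ) ≤ (p.1.1 : ℝ)⁻¹ := by positivity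
      calc _ ≤ (p.1.1 : ℝ)⁻¹ * 1 * 1 := by gcongr; exact hγ _ h3
        _ = _ := by ring) n
  have hleft : ∀ x : ℤ, ∑ p ∈ t, ((p.1.1 : ℂ)⁻¹ *
      ((ArithmeticFunction.moebius p.1.1 : ℂ) * p.1.2 ^ b) * γ p.2) *
      (p.1.2 ^ (W : ℤ) * z p.2) ^ x =
      ((∑ q ∈ sieveSet W R, (q : ℝ)⁻¹ * (ArithmeticFunction.moebius q *
        ramanujanSum (W * x + b) q) : ℝ) : ℂ) * ∑ i ∈ s, γ i * z i ^ x := by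
    intro x
    rw [ht, sum_product, sum_sigma]
    push_cast
    rw [Finset.sum_mul]
    refine sum_congr rfl fun q hq => ?_
    rw [ofReal_ramanujanSum _ (hpos q hq), Finset.mul_sum, Finset.mul_sum, sum_comm]
    refine sum_congr rfl fun i _ => ?_
    rw [Finset.mul_sum, Finset.sum_mul]
    refine sum_congr rfl fun ζ hζ => ?_
    have hζ0 : ζ ≠ 0 := by
      intro h0
      simpa [h0] using norm_of_mem_primitiveRoots (hpos q hq) hζ
    rw [mul_zpow, zpow_add₀ hζ0, zpow_mul]
    ring
  have hright : ∀ x : ℤ, ∑ p ∈ t, (((p.1.1 : ℝ)⁻¹ : ℝ) : ℂ) * (p.1.2 ^ (W : ℤ) * z p.2) ^ x =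
      (ramanujanWeight (sieveSet W R) x : ℂ) * ∑ i ∈ s, z i ^ x := by
    intro x
    rw [ht, sum_product, sum_sigma, ramanujanWeight]
    push_cast
    rw [Finset.sum_mul]
    refine sum_congr rfl fun q hq => ?_
    rw [← ramanujanSum_mul_left (hcop q hq), ofReal_ramanujanSum _ (hpos q hq), Finset.mul_sum,
      sum_comm]
    refine sum_congr rfl fun i _ => ?_
    rw [Finset.mul_sum, Finset.sum_mul]
    refine sum_congr rfl fun ζ hζ => ?_
    rw [mul_zpow, zpow_mul]
    ring
  simp only [hleft, hright] at key
  refine key.trans (le_of_eq ?_)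
  rw [energy]
  refine sum_congr rfl fun u _ => sum_congr rfl fun v _ => ?_
  rw [norm_mul, mul_pow, Complex.norm_real, Real.norm_eq_abs, sq_abs]

theorem mul_sum_Icc_le_sum_range_sub (Φ : ℤ → ℝ) (hΦ : ∀ x, 0 ≤ Φ x) (N : ℕ) :
    N * ∑ x ∈ Icc 1 N, Φ x ≤
      ∑ u ∈ range (2 * N), ∑ v ∈ range (2 * N), Φ ((u : ℤ) - v) := by
  rw [sum_comm]
  calc N * ∑ x ∈ Icc 1 N, Φ x = ∑ v ∈ range N, ∑ x ∈ Icc 1 N, Φ x := by simp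
    _ ≤ ∑ v ∈ range N, ∑ u ∈ range (2 * N), Φ ((u : ℤ) - v) := by
        refine sum_le_sum fun v hv => ?_
        have hinj : Set.InjOn (fun x => x + v) (Icc 1 N : Finset ℕ) := fun x _ y _ h => by
          simpa using h
        calc ∑ x ∈ Icc 1 N, Φ x = ∑ u ∈ (Icc 1 N).image (fun x => x + v), Φ ((u : ℤ) - v) := by
              rw [sum_image hinj]
              simp
          _ ≤ _ := by
              refine sum_le_sum_of_subset_of_nonneg ?_ fun _ _ _ => hΦ _
              intro u hu
              simp only [mem_image, mem_Icc, mem_range] at hu hv ⊢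
              omega
    _ ≤ _ := by
        refine sum_le_sum_of_subset_of_nonneg ?_ fun _ _ _ => sum_nonneg fun _ _ => hΦ _
        intro v hv
        simp only [mem_range] at hv ⊢
        omega

/-- The `x ≤ N` for which `Wx + b` is a prime exceeding `R`. -/
noncomputable def largePrimes (b W N R : ℕ) : Finset ℕ :=
  (Icc 1 N).filter fun x => (W * x + b).Prime ∧ R < W * x + b

theorem sum_moebius_mul_ramanujanSum {b W N R x : ℕ} (hx : x ∈ largePrimes b W N R) :
    ∑ q ∈ sieveSet W R, (q : ℝ)⁻¹ * (ArithmeticFunction.moebius q *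
        ramanujanSum (W * (x : ℤ) + b) q) = ∑ q ∈ sieveSet W R, (q : ℝ)⁻¹ := by
  obtain ⟨-, hp, hR⟩ := mem_filter.1 hx
  refine sum_congr rfl fun q hq => ?_
  obtain ⟨hq1, hsq, -⟩ := mem_filter.1 hq
  obtain ⟨hq1, hqR⟩ := mem_Icc.1 hq1
  have hcop : IsCoprime ((W * x + b : ℕ) : ℤ) (q : ℤ) := by
    refine Nat.isCoprime_iff_coprime.2 ((Nat.Prime.coprime_iff_not_dvd hp).2 fun h => ?_)
    exact absurd (Nat.le_of_dvd hq1 h) (by omega)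
  push_cast at hcop
  rw [ramanujanSum_of_isCoprime hcop]
  have : (ArithmeticFunction.moebius q : ℝ) * ArithmeticFunction.moebius q = 1 := by
    have := ArithmeticFunction.moebius_sq_eq_one_of_squarefree hsq
    rw [sq] at this
    exact_mod_cast this
  rw [this, mul_one]

theorem norm_sq_sum_largePrimes_le (hz : ∀ i ∈ s, ‖z i‖ = 1) {γ : ι → ℂ}
    (hγ : ∀ i ∈ s, ‖γ i‖ ≤ 1) (f : ℕ → ℂ) {b W N R : ℕ} (hR : 0 < R) :
    ‖∑ x ∈ largePrimes b W N R, f x * ∑ i ∈ s, γ i * z i ^ x‖ ^ 2 *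
      (N * ∑ q ∈ sieveSet W R, (q : ℝ)⁻¹) ≤
    (∑ x ∈ largePrimes b W N R, ‖f x‖ ^ 2) * weightedEnergy s z (2 * N) (R ^ 2) := by
  set L := ∑ q ∈ sieveSet W R, (q : ℝ)⁻¹ with hL
  set X := largePrimes b W N R
  have hone : 1 ∈ sieveSet W R := by
    simp only [sieveSet, mem_filter, mem_Icc, le_refl, true_and, squarefree_one,
      Nat.coprime_one_right_iff, and_true]
    exact hR
  have hLpos : 0 < L := sum_pos' (fun q _ => by positivity) ⟨1, hone, by norm_num⟩
  set K : ℤ → ℝ := fun x => ∑ q ∈ sieveSet W R, (q : ℝ)⁻¹ * (ArithmeticFunction.moebius q *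
    ramanujanSum (W * x + b) q) with hK
  set T : ℤ → ℂ := fun x => ∑ i ∈ s, γ i * z i ^ x with hT
  have hsieve : N * ∑ x ∈ Icc 1 N, ‖(K x : ℂ) * T x‖ ^ 2 ≤
      L * weightedEnergy s z (2 * N) (R ^ 2) := by
    refine (mul_sum_Icc_le_sum_range_sub (fun x => ‖(K x : ℂ) * T x‖ ^ 2)
      (fun x => sq_nonneg _) N).trans ?_
    refine (sum_norm_sq_moebius_le hz hγ b W R).trans ?_
    refine energy_ramanujanWeight_sq_le hz (R := R) ?_ ?_ ?_
    · exact fun q hq => (mem_filter.1 hq).2.1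
    · exact fun q hq => (mem_Icc.1 (mem_filter.1 hq).1).2
    · intro q hq d hd
      obtain ⟨h1, h2, h3⟩ := mem_filter.1 hq
      rw [mem_Icc] at h1
      refine mem_filter.2 ⟨mem_Icc.2 ⟨Nat.pos_of_dvd_of_pos hd h1.1,
        (Nat.le_of_dvd h1.1 hd).trans h1.2⟩, h2.squarefree_of_dvd hd, h3.coprime_dvd_right hd⟩
  have hcs : ‖∑ x ∈ X, f x * ((K x : ℂ) * T x)‖ ^ 2 ≤
      (∑ x ∈ X, ‖f x‖ ^ 2) * ∑ x ∈ Icc 1 N, ‖(K x : ℂ) * T x‖ ^ 2 := by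
    calc ‖∑ x ∈ X, f x * ((K x : ℂ) * T x)‖ ^ 2
        ≤ (∑ x ∈ X, ‖f x‖ * ‖(K x : ℂ) * T x‖) ^ 2 := by
          gcongr
          refine (norm_sum_le _ _).trans (le_of_eq ?_)
          simp only [norm_mul]
      _ ≤ (∑ x ∈ X, ‖f x‖ ^ 2) * ∑ x ∈ X, ‖(K x : ℂ) * T x‖ ^ 2 := sum_mul_sq_le_sq_mul_sq _ _ _
      _ ≤ _ := by
          gcongr
          exact filter_subset _ _
  have heq : ∑ x ∈ X, f x * ((K x : ℂ) * T x) =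
      L * ∑ x ∈ X, f x * ∑ i ∈ s, γ i * z i ^ x := by
    rw [Finset.mul_sum]
    refine sum_congr rfl fun x hx => ?_
    rw [show K x = L from sum_moebius_mul_ramanujanSum hx]
    simp only [hT, zpow_natCast]
    ring
  rw [heq, norm_mul, mul_pow, Complex.norm_real, Real.norm_of_nonneg hLpos.le] at hcs
  have h1 := mul_le_mul_of_nonneg_left hcs (Nat.cast_nonneg (α := ℝ) N)
  have h2 := mul_le_mul_of_nonneg_left hsieve
    (sum_nonneg fun x (_ : x ∈ X) => sq_nonneg ‖f x‖)
  refine le_of_mul_le_mul_left ?_ hLpos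
  linarith

end Majorant

section CoprimeHarmonic

theorem sum_inv_coprime_le (W R : ℕ) :
    ∑ n ∈ (Icc 1 R).filter (fun n => W.Coprime n), (n : ℝ)⁻¹ ≤
      2 * ∑ q ∈ sieveSet W R, (q : ℝ)⁻¹ := by
  choose q m hm hq using Nat.sq_mul_squarefree
  set S := (Icc 1 R).filter (fun n => W.Coprime n)
  have hinj : Set.InjOn (fun n => (q n, m n)) (S : Set ℕ) := by
    intro x _ y _ h
    simp only [Prod.mk.injEq] at h
    rw [← hm x, ← hm y, h.1, h.2]
  have hsub : S.image (fun n => (q n, m n)) ⊆ sieveSet W R ×ˢ Ioo 0 (R + 1) := by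
    intro p hp
    obtain ⟨n, hn, rfl⟩ := mem_image.1 hp
    obtain ⟨hn1, hn2⟩ := mem_filter.1 hn
    rw [mem_Icc] at hn1
    have hqd : q n ∣ n := ⟨m n ^ 2, by rw [mul_comm, hm]⟩
    have hmd : m n ∣ n := ⟨m n * q n, by rw [← mul_assoc, ← sq, hm]⟩
    have h1 := Nat.le_of_dvd hn1.1 hqd
    have h2 := Nat.le_of_dvd hn1.1 hmd
    have h3 := Nat.pos_of_dvd_of_pos hqd hn1.1
    have h4 := Nat.pos_of_dvd_of_pos hmd hn1.1
    simp only [mem_product, sieveSet, mem_filter, mem_Icc, mem_Ioo]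
    exact ⟨⟨⟨h3, h1.trans hn1.2⟩, hq n, hn2.coprime_dvd_right hqd⟩, h4, by omega⟩
  calc ∑ n ∈ S, (n : ℝ)⁻¹ = ∑ p ∈ S.image (fun n => (q n, m n)),
        (p.1 : ℝ)⁻¹ * ((p.2 : ℝ) ^ 2)⁻¹ := by
        rw [sum_image hinj]
        refine sum_congr rfl fun n _ => ?_
        conv_lhs => rw [← hm n]
        push_cast
        rw [mul_inv, mul_comm]
    _ ≤ ∑ p ∈ sieveSet W R ×ˢ Ioo 0 (R + 1), (p.1 : ℝ)⁻¹ * ((p.2 : ℝ) ^ 2)⁻¹ :=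
        sum_le_sum_of_subset_of_nonneg hsub fun _ _ _ => by positivity
    _ = (∑ q ∈ sieveSet W R, (q : ℝ)⁻¹) * ∑ m ∈ Ioo 0 (R + 1), ((m : ℝ) ^ 2)⁻¹ := by
        rw [sum_product, sum_mul_sum]
    _ ≤ (∑ q ∈ sieveSet W R, (q : ℝ)⁻¹) * 2 := by
        have := sum_Ioo_inv_sq_le (α := ℝ) 0 (R + 1)
        norm_num at this
        gcongr
    _ = _ := mul_comm _ _

theorem totient_div_mul_harmonic_le {W : ℕ} (hW : 0 < W) (T : ℕ) :
    (W.totient : ℝ) / W * (harmonic T : ℝ) ≤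
      ∑ n ∈ (Ico 1 (T * W + 1)).filter (fun n => W.Coprime n), (n : ℝ)⁻¹ := by
  have hW0 : (0 : ℝ) < W := by exact_mod_cast hW
  induction T with
  | zero => simp
  | succ T ih =>
    have hdisj : Disjoint ((Ico 1 (T * W + 1)).filter (fun n => W.Coprime n))
        ((Ico (T * W + 1) (T * W + 1 + W)).filter (fun n => W.Coprime n)) := by
      refine disjoint_filter_filter (disjoint_left.2 fun x hx hx' => ?_)
      rw [mem_Ico] at hx hx'
      omega
    have hunion : (Ico 1 ((T + 1) * W + 1)).filter (fun n => W.Coprime n) =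
        (Ico 1 (T * W + 1)).filter (fun n => W.Coprime n) ∪
        (Ico (T * W + 1) (T * W + 1 + W)).filter (fun n => W.Coprime n) := by
      rw [← filter_union, Ico_union_Ico_eq_Ico (by omega) (by omega)]
      congr 2
      ring
    rw [hunion, sum_union hdisj, harmonic_succ]
    push_cast
    rw [mul_add]
    refine add_le_add ih ?_
    calc (W.totient : ℝ) / W * (T + 1 : ℝ)⁻¹ = #((Ico (T * W + 1) (T * W + 1 + W)).filter
          (fun n => W.Coprime n)) • (((T + 1) * W : ℝ)⁻¹) := by
          rw [Nat.filter_coprime_Ico_eq_totient, nsmul_eq_mul, mul_inv]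
          ring
      _ ≤ _ := by
          refine card_nsmul_le_sum _ _ _ fun n hn => ?_
          have hn := mem_Ico.1 (mem_filter.1 hn).1
          have h1 : (0 : ℝ) < n := by exact_mod_cast (by omega : 0 < n)
          gcongr
          have : n ≤ (T + 1) * W := by rw [add_mul]; omega
          exact_mod_cast this

theorem totient_div_mul_log_le {W : ℕ} (hW : 0 < W) (R : ℕ) :
    (W.totient : ℝ) / W * Real.log (((R : ℝ) + 1) / W) ≤
      2 * ∑ q ∈ sieveSet W R, (q : ℝ)⁻¹ := by
  have hW0 : (0 : ℝ) < W := by exact_mod_cast hW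
  refine le_trans ?_ (sum_inv_coprime_le W R)
  have hsub : (Ico 1 (R / W * W + 1)).filter (fun n => W.Coprime n) ⊆
      (Icc 1 R).filter (fun n => W.Coprime n) := by
    refine filter_subset_filter _ fun n hn => ?_
    rw [mem_Ico] at hn
    have := Nat.div_mul_le_self R W
    exact mem_Icc.2 ⟨hn.1, by omega⟩
  refine le_trans ?_ (sum_le_sum_of_subset_of_nonneg hsub fun _ _ _ => by positivity)
  refine le_trans ?_ (totient_div_mul_harmonic_le hW (R / W))
  refine mul_le_mul_of_nonneg_left ?_ (by positivity)
  refine le_trans (Real.log_le_log (by positivity) ?_) (log_add_one_le_harmonic (R / W))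
  rw [div_le_iff₀ hW0]
  have h := Nat.lt_div_mul_add (a := R) hW
  have : R + 1 ≤ (R / W + 1) * W := by rw [add_mul]; omega
  exact_mod_cast this

end CoprimeHarmonic

section Parameters

theorem eventually_mul_log_pow_le (D : ℝ) (n : ℕ) {c : ℝ} (hc : 0 < c) :
    ∀ᶠ N : ℕ in Filter.atTop, D * Real.log N ^ n ≤ (N : ℝ) ^ c := by
  have h := (isLittleO_log_rpow_rpow_atTop (n : ℝ) hc).const_mul_left D
  have h1 := (h.bound one_pos).and (Filter.eventually_ge_atTop 1)
  filter_upwards [tendsto_natCast_atTop_atTop.eventually h1] with N hN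
  have h2 := hN.1
  rw [one_mul, Real.norm_of_nonneg (by positivity : (0 : ℝ) ≤ (N : ℝ) ^ c),
    Real.rpow_natCast] at h2
  exact (Real.le_norm_self _).trans h2

theorem eventually_one_le_log : ∀ᶠ N : ℕ in Filter.atTop, 1 ≤ Real.log N :=
  (Real.tendsto_log_atTop.comp tendsto_natCast_atTop_atTop).eventually_ge_atTop 1

end Parameters

section Sieve

theorem weightedEnergy_nonneg {ι : Type*} {s : Finset ι} {z : ι → ℂ} (hz : ∀ i ∈ s, ‖z i‖ = 1)
    (n M : ℕ) : 0 ≤ weightedEnergy s z n M :=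
  sum_nonneg fun q hq => mul_nonneg (by positivity)
    (energy_ramanujanSum_nonneg hz (mem_Icc.1 hq).1)

theorem exists_card_largePrimes_mul_le :
    ∃ C : ℝ, 0 < C ∧ ∀ b W N R : ℕ, 0 < R → 0 < N → R ^ 12 ≤ N ^ 2 →
      #(largePrimes b W N R) * ∑ q ∈ sieveSet W R, (q : ℝ)⁻¹ ≤ C * N := by
  obtain ⟨C, hC, hE⟩ := exists_weightedEnergy_le
  refine ⟨20 * C, by positivity, fun b W N R hR hN hRN => ?_⟩
  have hN0 : (0 : ℝ) < N := by exact_mod_cast hN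
  set L := ∑ q ∈ sieveSet W R, (q : ℝ)⁻¹
  have hz : ∀ i ∈ ({()} : Finset Unit), ‖(fun _ : Unit => (1 : ℂ)) i‖ = 1 := by simp
  have h1 := norm_sq_sum_largePrimes_le (b := b) (W := W) (N := N) hz (γ := fun _ => 1) (by simp)
    (fun _ => 1) hR
  have h2 := (hE {()} (fun _ => 1) (2 * N) (R ^ 2) hz).1
  have hRN' : (R : ℝ) ^ 12 ≤ (N : ℝ) ^ 2 := by exact_mod_cast hRN
  simp only [one_pow, mul_one, sum_const, nsmul_eq_mul, norm_one,
    Complex.norm_natCast, card_singleton, Nat.cast_one, one_mul] at h1 h2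
  push_cast at h2
  rw [← pow_mul] at h2
  have h3 : C * ((2 * (N : ℝ)) ^ 2 + 16 * (R : ℝ) ^ (2 * 6)) ≤ C * (20 * (N : ℝ) ^ 2) := by
    gcongr
    norm_num
    nlinarith
  rcases (largePrimes b W N R).eq_empty_or_nonempty with h0 | h0
  · rw [h0]
    simp only [card_empty, Nat.cast_zero, zero_mul]
    positivity
  · have hX : (0 : ℝ) < #(largePrimes b W N R) := by exact_mod_cast h0.card_pos
    refine le_of_mul_le_mul_left (a := #(largePrimes b W N R) * (N : ℝ)) ?_ (by positivity)
    have h4 := mul_le_mul_of_nonneg_left (h2.trans h3) hX.le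
    linarith

theorem exists_norm_sq_sum_largePrimes_le :
    ∃ C : ℝ, 0 < C ∧ ∀ {ι : Type} (s : Finset ι) (z γ : ι → ℂ) (f : ℕ → ℂ) (m : ℝ) (b W N R : ℕ),
      (∀ i ∈ s, ‖z i‖ = 1) → (∀ i ∈ s, ‖γ i‖ ≤ 1) → 0 < R → 0 < N → R ^ 12 ≤ N ^ 2 →
      (∀ x ∈ largePrimes b W N R, ‖f x‖ ≤ m) →
      ‖∑ x ∈ largePrimes b W N R, f x * ∑ i ∈ s, γ i * z i ^ x‖ ^ 2 *
        (∑ q ∈ sieveSet W R, (q : ℝ)⁻¹) ^ 2 ≤ C * m ^ 2 * weightedEnergy s z (2 * N) (R ^ 2) := by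
  obtain ⟨C, hC, hcard⟩ := exists_card_largePrimes_mul_le
  refine ⟨C, hC, fun s z γ f m b W N R hz hγ hR hN hRN hf => ?_⟩
  have hN0 : (0 : ℝ) < N := by exact_mod_cast hN
  have h1 := norm_sq_sum_largePrimes_le hz hγ f (b := b) (W := W) (N := N) hR
  have h2 := hcard b W N R hR hN hRN
  set L := ∑ q ∈ sieveSet W R, (q : ℝ)⁻¹
  have hL : 0 ≤ L := sum_nonneg fun _ _ => by positivity
  have hE := weightedEnergy_nonneg hz (2 * N) (R ^ 2)
  have h3 : ∑ x ∈ largePrimes b W N R, ‖f x‖ ^ 2 ≤ #(largePrimes b W N R) * m ^ 2 := by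
    rw [← nsmul_eq_mul]
    refine sum_le_card_nsmul _ _ _ fun x hx => ?_
    gcongr
    exact hf x hx
  refine le_of_mul_le_mul_left (a := (N : ℝ)) ?_ hN0
  calc _ = L * (‖∑ x ∈ largePrimes b W N R, f x * ∑ i ∈ s, γ i * z i ^ x‖ ^ 2 * (N * L)) := by ring
    _ ≤ L * (#(largePrimes b W N R) * m ^ 2 * weightedEnergy s z (2 * N) (R ^ 2)) := by
        refine mul_le_mul_of_nonneg_left (h1.trans ?_) hL
        exact mul_le_mul_of_nonneg_right h3 hE
    _ = (#(largePrimes b W N R) * L) * (m ^ 2 * weightedEnergy s z (2 * N) (R ^ 2)) := by ring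
    _ ≤ (C * N) * (m ^ 2 * weightedEnergy s z (2 * N) (R ^ 2)) := by gcongr
    _ = _ := by ring

end Sieve

section Fourier

variable {N : ℕ} [NeZero N]

theorem eC_neg_mul_div (x : ℕ) (r : ZMod N) :
    eC (-((x : ℝ) * (r.val : ℝ)) / N) = ((ZMod.stdAddChar r : ℂ)⁻¹) ^ x := by
  rw [ZMod.stdAddChar_apply, ZMod.toCircle_apply, eC, ← Complex.exp_neg, ← Complex.exp_nat_mul]
  congr 1
  push_cast
  ring

theorem dft_eq_sum_stdAddChar (a : ZMod N → ℝ) (r : ZMod N) :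
    dft N a r = ∑ x ∈ Icc 1 N, (a x : ℂ) * ((ZMod.stdAddChar r : ℂ)⁻¹) ^ x :=
  sum_congr rfl fun x _ => by rw [eC_neg_mul_div]

theorem inv_stdAddChar_pow (r : ZMod N) : ((ZMod.stdAddChar r : ℂ)⁻¹) ^ N = 1 := by
  rw [inv_pow, ← AddChar.map_nsmul_eq_pow]
  simp

theorem injective_inv_stdAddChar :
    Function.Injective fun r : ZMod N => (ZMod.stdAddChar r : ℂ)⁻¹ :=
  fun _ _ h => ZMod.injective_stdAddChar (inv_injective h)

theorem sum_norm_dft_sq (a : ZMod N → ℝ) :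
    ∑ r : ZMod N, ‖dft N a r‖ ^ 2 = N * ∑ x ∈ Icc 1 N, a x ^ 2 := by
  apply Complex.ofReal_injective
  push_cast
  have horth : ∀ x ∈ Icc 1 N, ∀ y ∈ Icc 1 N,
      ∑ r : ZMod N, ((ZMod.stdAddChar r : ℂ)⁻¹) ^ x *
        (starRingEnd ℂ) (((ZMod.stdAddChar r : ℂ)⁻¹) ^ y) = if x = y then (N : ℂ) else 0 := by
    intro x hx y hy
    have hterm : ∀ r : ZMod N, ((ZMod.stdAddChar r : ℂ)⁻¹) ^ x *
        (starRingEnd ℂ) (((ZMod.stdAddChar r : ℂ)⁻¹) ^ y) =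
        ZMod.stdAddChar (r * ((y : ZMod N) - (x : ZMod N))) := by
      intro r
      have hn : ‖(ZMod.stdAddChar r : ℂ)⁻¹‖ = 1 :=
        Complex.norm_eq_one_of_pow_eq_one (inv_stdAddChar_pow r) (NeZero.ne N)
      rw [map_pow, ← Complex.inv_eq_conj hn, inv_inv, mul_sub, AddChar.map_sub_eq_div,
        mul_comm r, mul_comm r, ← nsmul_eq_mul, ← nsmul_eq_mul, AddChar.map_nsmul_eq_pow,
        AddChar.map_nsmul_eq_pow, inv_pow, div_eq_mul_inv, mul_comm]
    rw [sum_congr rfl fun r _ => hterm r,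
      AddChar.sum_mulShift _ (ZMod.isPrimitive_stdAddChar N), ZMod.card]
    rw [mem_Icc] at hx hy
    have : (y : ZMod N) - (x : ZMod N) = 0 ↔ x = y := by
      rw [sub_eq_zero, ZMod.natCast_eq_natCast_iff, Nat.modEq_iff_dvd]
      constructor
      · rintro ⟨c, hc⟩
        have h1 : c = 0 := by
          by_contra h0
          rcases lt_or_gt_of_ne h0 with h | h
          · nlinarith
          · nlinarith
        rw [h1, mul_zero] at hc
        omega
      · rintro rfl
        simp
    simp only [this]
    push_cast
    rfl
  calc ∑ r : ZMod N, (‖dft N a r‖ : ℂ) ^ 2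
      = ∑ r : ZMod N, ∑ x ∈ Icc 1 N, ∑ y ∈ Icc 1 N, ((a x : ℂ) * a y) *
        (((ZMod.stdAddChar r : ℂ)⁻¹) ^ x *
          (starRingEnd ℂ) (((ZMod.stdAddChar r : ℂ)⁻¹) ^ y)) := by
        refine sum_congr rfl fun r _ => ?_
        rw [← Complex.mul_conj', dft_eq_sum_stdAddChar, map_sum, sum_mul_sum]
        refine sum_congr rfl fun x _ => sum_congr rfl fun y _ => ?_
        rw [map_mul, Complex.conj_ofReal]
        ring
    _ = ∑ x ∈ Icc 1 N, ∑ y ∈ Icc 1 N, ((a x : ℂ) * a y) * (if x = y then (N : ℂ) else 0) := by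
        rw [sum_comm]
        refine sum_congr rfl fun x hx => ?_
        rw [sum_comm]
        refine sum_congr rfl fun y hy => ?_
        rw [← Finset.mul_sum, horth x hx y hy]
    _ = _ := by
        rw [Finset.mul_sum]
        refine sum_congr rfl fun x hx => ?_
        simp only [mul_ite, mul_zero, sum_ite_eq, hx, if_true]
        ring

end Fourier

section LevelSum

theorem sum_rpow_le_of_card_le {κ : Type*} [Fintype κ] {g : κ → ℝ} {ρ η C δ₀ D : ℝ}
    (hη : 0 < η) (hρ : ρ = 2 + 2 * η) (hC : 0 < C) (hδ₀ : 0 < δ₀) (hδ₀1 : δ₀ ≤ 1)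
    (hg : ∀ r, 0 ≤ g r) (hgC : ∀ r, g r ≤ C)
    (hcard : ∀ δ, δ₀ ≤ δ → δ ≤ 1 → ∀ s : Finset κ, (∀ r ∈ s, δ ≤ g r) →
      (#s : ℝ) ≤ C * ((δ ^ 2)⁻¹ * δ ^ (-η)))
    (hsmall : δ₀ ^ (2 * η) * ∑ r, g r ^ 2 ≤ D) :
    ∑ r, g r ^ ρ ≤ D + C * C ^ ρ +
      C * (2 : ℝ) ^ (2 + η) * (1 - (1 / 2 : ℝ) ^ η)⁻¹ := by
  classical
  have hρ0 : 0 ≤ ρ := by linarith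
  rw [← sum_filter_add_sum_filter_not univ (fun r => g r < δ₀),
    ← sum_filter_add_sum_filter_not ({r | ¬ g r < δ₀} : Finset κ) (fun r => 1 < g r), ← add_assoc]
  refine add_le_add (add_le_add ?_ ?_) ?_
  · refine le_trans ?_ hsmall
    rw [Finset.mul_sum]
    refine (sum_le_sum fun r hr => ?_).trans
      (sum_le_sum_of_subset_of_nonneg (filter_subset _ _) fun r _ _ => ?_)
    · rcases (hg r).eq_or_lt with h0 | h0
      · rw [← h0, Real.zero_rpow (by linarith)]
        positivity
      · rw [hρ, add_comm, Real.rpow_add h0, Real.rpow_two]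
        gcongr
        exact le_of_lt (by simpa using hr)
    · positivity
  · have h1 := hcard 1 hδ₀1 le_rfl (({r | ¬ g r < δ₀} : Finset κ).filter fun r => 1 < g r)
      fun r hr => (mem_filter.1 hr).2.le
    simp only [one_pow, inv_one, Real.one_rpow, mul_one] at h1
    refine (sum_le_card_nsmul _ _ (C ^ ρ) fun r _ => ?_).trans ?_
    · exact Real.rpow_le_rpow (hg r) (hgC r) hρ0
    · rw [nsmul_eq_mul]
      gcongr
  · set S := (({r | ¬ g r < δ₀} : Finset κ).filter fun r => ¬ 1 < g r) with hS
    have hSmem : ∀ r ∈ S, δ₀ ≤ g r ∧ g r ≤ 1 := by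
      intro r hr
      simpa [hS] using hr
    have hj : ∀ r, ∃ j : ℕ, r ∈ S → (1 / 2 : ℝ) ^ (j + 1) < g r ∧ g r ≤ (1 / 2 : ℝ) ^ j := by
      intro r
      by_cases hr : r ∈ S
      · obtain ⟨j, hj⟩ := exists_nat_pow_near_of_lt_one (hδ₀.trans_le (hSmem r hr).1)
          (hSmem r hr).2 (by norm_num : (0 : ℝ) < 1 / 2) (by norm_num)
        exact ⟨j, fun _ => hj⟩
      · exact ⟨0, fun h => absurd h hr⟩
    choose j hj using hj
    have hlevel : ∀ i ∈ S.image j, ∑ r ∈ S with j r = i, g r ^ ρ ≤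
        C * (2 : ℝ) ^ (2 + η) * ((1 / 2 : ℝ) ^ η) ^ i := by
      intro i hi
      obtain ⟨r₀, hr₀, rfl⟩ := mem_image.1 hi
      set i := j r₀
      set δ := max δ₀ ((1 / 2 : ℝ) ^ (i + 1)) with hδ
      have hp : (0 : ℝ) < (1 / 2 : ℝ) ^ (i + 1) := by positivity
      have hδp : (1 / 2 : ℝ) ^ (i + 1) ≤ δ := le_max_right _ _
      have hδ1 : δ ≤ 1 := max_le hδ₀1 (pow_le_one₀ (by norm_num) (by norm_num))
      have h1 := hcard δ (le_max_left _ _) hδ1 (S.filter fun r => j r = i) (by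
        intro r hr
        obtain ⟨hr1, hr2⟩ := mem_filter.1 hr
        have := (hj r hr1).1
        rw [hr2] at this
        exact max_le (hSmem r hr1).1 this.le)
      have h2 : (δ ^ 2)⁻¹ * δ ^ (-η) ≤ ((1 / 2 : ℝ) ^ (i + 1)) ^ (-(2 + η)) := by
        have hδ0 : 0 < δ := hp.trans_le hδp
        rw [← Real.rpow_two, ← Real.rpow_neg hδ0.le, ← Real.rpow_add hδ0, ← neg_add]
        exact Real.rpow_le_rpow_of_nonpos hp hδp (by linarith)
      have h3 : ∑ r ∈ S with j r = i, g r ^ ρ ≤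
          #(S.filter fun r => j r = i) • ((1 / 2 : ℝ) ^ i) ^ ρ := by
        refine sum_le_card_nsmul _ _ _ fun r hr => ?_
        obtain ⟨hr1, hr2⟩ := mem_filter.1 hr
        have := (hj r hr1).2
        rw [hr2] at this
        exact Real.rpow_le_rpow (hg r) this hρ0
      rw [nsmul_eq_mul] at h3
      calc _ ≤ _ := h3
        _ ≤ C * ((1 / 2 : ℝ) ^ (i + 1)) ^ (-(2 + η)) * ((1 / 2 : ℝ) ^ i) ^ ρ := by
            gcongr
            exact h1.trans (mul_le_mul_of_nonneg_left h2 hC.le)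
        _ = _ := by
            have hh : (0 : ℝ) < 1 / 2 := by norm_num
            have h22 : (2 : ℝ) = (1 / 2 : ℝ) ^ (-1 : ℝ) := by
              rw [Real.rpow_neg_one]; norm_num
            conv_rhs => rw [show (2 : ℝ) ^ (2 + η) = ((1 / 2 : ℝ) ^ (-1 : ℝ)) ^ (2 + η) by
              rw [← h22]]
            rw [← Real.rpow_natCast, ← Real.rpow_natCast, ← Real.rpow_natCast, ← Real.rpow_mul hh.le,
              ← Real.rpow_mul hh.le, ← Real.rpow_mul hh.le, ← Real.rpow_mul hh.le, mul_assoc,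
              mul_assoc, ← Real.rpow_add hh, ← Real.rpow_add hh, hρ]
            congr 2
            push_cast
            ring
    have hlt : (1 / 2 : ℝ) ^ η < 1 := Real.rpow_lt_one (by norm_num) (by norm_num) hη
    rw [← sum_fiberwise_of_maps_to (fun r hr => mem_image_of_mem j hr)]
    refine (sum_le_sum hlevel).trans ?_
    rw [← Finset.mul_sum]
    refine mul_le_mul_of_nonneg_left ?_ (by positivity)
    rw [← tsum_geometric_of_lt_one (by positivity) hlt]
    exact (summable_geometric_of_lt_one (by positivity) hlt).sum_le_tsum _
      fun _ _ => by positivity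

end LevelSum

section PrimeFourier

theorem lam_nonneg (b W x : ℕ) : 0 ≤ lam b W x := by
  unfold lam
  split_ifs with h
  · have : (1 : ℝ) ≤ W * x + b := by exact_mod_cast h.one_le
    have := Real.log_nonneg this
    positivity
  · exact le_rfl

theorem lam_le {b W x N : ℕ} (h : W * x + b ≤ N ^ 2) :
    lam b W x ≤ (W.totient : ℝ) / W * (2 * Real.log N) := by
  unfold lam
  split_ifs with hp
  · refine mul_le_mul_of_nonneg_left ?_ (by positivity)
    have h1 : (0 : ℝ) < W * x + b := by exact_mod_cast hp.pos
    have h2 : (W * x + b : ℝ) ≤ (N : ℝ) ^ 2 := by exact_mod_cast h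
    refine (Real.log_le_log h1 h2).trans (le_of_eq ?_)
    rw [Real.log_pow]
    norm_num
  · have := Real.log_natCast_nonneg N
    positivity

/-- The main inequality for the large values of the transform of a function supported on primes. -/
theorem exists_card_sq_mul_le_weightedEnergy :
    ∃ C : ℝ, 0 < C ∧ ∀ (N : ℕ) [NeZero N] (b W R : ℕ) (a : ZMod N → ℝ) (κ m δ : ℝ)
      (s : Finset (ZMod N)), 0 < R → R ^ 12 ≤ N ^ 2 → 0 < κ → 0 < m → 0 < δ → 0 < W →
      (∀ x ∈ Icc 1 N, ¬ (W * x + b).Prime → a x = 0) → (∀ x ∈ Icc 1 N, |a x| ≤ m) →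
      R * m ≤ δ / 2 → m * N ≤ κ * ∑ q ∈ sieveSet W R, (q : ℝ)⁻¹ →
      (∀ r ∈ s, δ ≤ ‖dft N a r‖) →
      (#s : ℝ) ^ 2 * δ ^ 2 * (N : ℝ) ^ 2 ≤ C * κ ^ 2 *
        weightedEnergy s (fun r => (ZMod.stdAddChar r : ℂ)⁻¹) (2 * N) (R ^ 2) := by
  obtain ⟨C, hC, hmain⟩ := exists_norm_sq_sum_largePrimes_le
  refine ⟨4 * C, by positivity, ?_⟩
  intro N _ b W R a κ m δ s hR hRN hκ hm hδ hW ha0 ham hRm hmL hs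
  have hN : 0 < N := Nat.pos_of_ne_zero (NeZero.ne N)
  have hN0 : (0 : ℝ) < N := by exact_mod_cast hN
  set z : ZMod N → ℂ := fun r => (ZMod.stdAddChar r : ℂ)⁻¹
  have hz : ∀ r, ‖z r‖ = 1 := fun r =>
    Complex.norm_eq_one_of_pow_eq_one (inv_stdAddChar_pow r) (NeZero.ne N)
  set P := largePrimes b W N R with hP
  set γ : ZMod N → ℂ := fun r => (starRingEnd ℂ) (dft N a r) / ‖dft N a r‖ with hγ
  have hγ1 : ∀ r, ‖γ r‖ ≤ 1 := fun r => by
    rw [hγ]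
    simp only [norm_div, RCLike.norm_conj, Complex.norm_real, norm_norm]
    exact div_self_le_one _
  have hrem : ∀ r, ‖dft N a r - ∑ x ∈ P, (a x : ℂ) * z r ^ x‖ ≤ δ / 2 := by
    intro r
    rw [dft_eq_sum_stdAddChar, ← sum_filter_add_sum_filter_not (Icc 1 N)
      (fun x => (W * x + b).Prime ∧ R < W * x + b), hP, largePrimes, add_sub_cancel_left]
    have hsub : ∑ x ∈ (Icc 1 N).filter (fun x => x ≤ R), m ≤ R * m := by
      rw [sum_const, nsmul_eq_mul]
      have : #((Icc 1 N).filter (fun x => x ≤ R)) ≤ #(Icc 1 R) := card_le_card fun x hx => by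
        simp only [mem_filter, mem_Icc] at hx ⊢
        omega
      rw [Nat.card_Icc, Nat.add_sub_cancel] at this
      gcongr
    refine (norm_sum_le _ _).trans (le_trans ?_ (hsub.trans hRm))
    rw [sum_filter, sum_filter]
    refine sum_le_sum fun x hx => ?_
    have hax : ‖(a x : ℂ) * ((ZMod.stdAddChar r : ℂ)⁻¹) ^ x‖ = |a x| := by
      rw [norm_mul, norm_pow, show ‖(ZMod.stdAddChar r : ℂ)⁻¹‖ = 1 from hz r, one_pow, mul_one,
        Complex.norm_real, Real.norm_eq_abs]
    rw [hax]
    have hxW : x ≤ W * x + b := by nlinarith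
    by_cases hp : (W * x + b).Prime
    · by_cases hxR : R < W * x + b
      · simp only [hp, hxR, and_self, not_true_eq_false, if_false]
        split_ifs <;> positivity
      · simp only [hp, hxR, and_false, not_false_eq_true, if_true,
          if_pos (hxW.trans (not_lt.1 hxR))]
        exact ham x hx
    · rw [ha0 x hx hp, abs_zero]
      split_ifs <;> positivity
  have hlow : ∀ r ∈ s, δ / 2 ≤ (γ r * ∑ x ∈ P, (a x : ℂ) * z r ^ x).re := by
    intro r hr
    have h0 : 0 < ‖dft N a r‖ := hδ.trans_le (hs r hr)
    have h1 : γ r * dft N a r = (‖dft N a r‖ : ℂ) := by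
      have : (‖dft N a r‖ : ℂ) ≠ 0 := by exact_mod_cast h0.ne'
      rw [hγ]
      simp only
      rw [div_mul_eq_mul_div, mul_comm, Complex.mul_conj', sq, mul_div_assoc, div_self this,
        mul_one]
    have h2 : ‖γ r * (dft N a r - ∑ x ∈ P, (a x : ℂ) * z r ^ x)‖ ≤ δ / 2 := by
      rw [norm_mul]
      exact (mul_le_of_le_one_left (norm_nonneg _) (hγ1 r)).trans (hrem r)
    have h3 := (Complex.re_le_norm _).trans h2
    rw [mul_sub, h1, Complex.sub_re, Complex.ofReal_re] at h3
    linarith [hs r hr]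
  have hbig : #s * (δ / 2) ≤ ‖∑ x ∈ P, (a x : ℂ) * ∑ r ∈ s, γ r * z r ^ x‖ := by
    have hswap : ∑ x ∈ P, (a x : ℂ) * ∑ r ∈ s, γ r * z r ^ x =
        ∑ r ∈ s, γ r * ∑ x ∈ P, (a x : ℂ) * z r ^ x := by
      simp only [Finset.mul_sum]
      rw [sum_comm]
      refine sum_congr rfl fun r _ => sum_congr rfl fun x _ => by ring
    rw [hswap]
    refine le_trans ?_ (Complex.re_le_norm _)
    rw [Complex.re_sum, ← nsmul_eq_mul]
    exact card_nsmul_le_sum _ _ _ hlow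
  have h1 := hmain s z γ (fun x => (a x : ℂ)) m b W N R (fun r _ => hz r) (fun r _ => hγ1 r) hR hN
    hRN (fun x hx => by
      rw [Complex.norm_real]
      exact ham x (mem_filter.1 hx).1)
  set L := ∑ q ∈ sieveSet W R, (q : ℝ)⁻¹
  have hE := weightedEnergy_nonneg (s := s) (fun r _ => hz r) (2 * N) (R ^ 2)
  set E := weightedEnergy s z (2 * N) (R ^ 2)
  have hL : 0 < L := by
    by_contra h
    have : 0 < m * N := by positivity
    nlinarith
  refine le_of_mul_le_mul_right (a := L ^ 2) ?_ (by positivity)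
  calc (#s : ℝ) ^ 2 * δ ^ 2 * (N : ℝ) ^ 2 * L ^ 2
      = 4 * (N : ℝ) ^ 2 * ((#s * (δ / 2)) ^ 2 * L ^ 2) := by ring
    _ ≤ 4 * (N : ℝ) ^ 2 * (C * m ^ 2 * E) := by
        refine mul_le_mul_of_nonneg_left (le_trans ?_ h1) (by positivity)
        gcongr
    _ = 4 * C * E * (m * N) ^ 2 := by ring
    _ ≤ 4 * C * E * (κ * L) ^ 2 := by gcongr
    _ = _ := by ring

end PrimeFourier

section Restriction

theorem eventually_parameters (K : ℝ) (A k : ℕ) :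
    ∃ N₀ : ℕ, ∀ N : ℕ, N₀ ≤ N → 1 ≤ N ∧ 1 ≤ Real.log N ∧
      4 * Real.log N ^ (A + 1) ≤ (N : ℝ) ^ (11 / 12 : ℝ) ∧
      (K * (Real.log N ^ A) ^ 4) ^ (k + 1) ≤ N ∧
      2 * Real.log N ≤ N ∧ Real.log N ≤ (N : ℝ) ^ (1 / 24 : ℝ) := by
  refine Filter.eventually_atTop.1 ?_
  filter_upwards [eventually_one_le_log, Filter.eventually_ge_atTop 1,
    eventually_mul_log_pow_le 4 (A + 1) (c := 11 / 12) (by norm_num),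
    eventually_mul_log_pow_le (K ^ (k + 1)) (A * 4 * (k + 1)) one_pos,
    eventually_mul_log_pow_le 2 1 one_pos,
    eventually_mul_log_pow_le 1 1 (c := 1 / 24) (by norm_num)] with N h1 h2 h3 h4 h5 h6
  refine ⟨h2, h1, h3, ?_, ?_, ?_⟩
  · rw [mul_pow, ← pow_mul, ← pow_mul]
    simpa [mul_assoc] using h4
  · simpa using h5
  · simpa using h6

theorem mul_log_le_sum_sieveSet {N W : ℕ} (hN : 1 ≤ N) (hW : 0 < W)
    (hWN : (W : ℝ) ≤ (N : ℝ) ^ (1 / 24 : ℝ)) :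
    (W.totient : ℝ) / W * (2 * Real.log N) ≤
      96 * ∑ q ∈ sieveSet W ⌊(N : ℝ) ^ (1 / 12 : ℝ)⌋₊, (q : ℝ)⁻¹ := by
  have hN0 : (0 : ℝ) < N := by exact_mod_cast hN
  have hW0 : (0 : ℝ) < W := by exact_mod_cast hW
  have h1 := totient_div_mul_log_le hW ⌊(N : ℝ) ^ (1 / 12 : ℝ)⌋₊
  have h2 : (N : ℝ) ^ (1 / 24 : ℝ) ≤ ((⌊(N : ℝ) ^ (1 / 12 : ℝ)⌋₊ : ℝ) + 1) / W := by
    rw [le_div_iff₀ hW0]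
    calc (N : ℝ) ^ (1 / 24 : ℝ) * W ≤ (N : ℝ) ^ (1 / 24 : ℝ) * (N : ℝ) ^ (1 / 24 : ℝ) := by gcongr
      _ = (N : ℝ) ^ (1 / 12 : ℝ) := by rw [← Real.rpow_add hN0]; norm_num
      _ ≤ _ := (Nat.lt_floor_add_one _).le
  have h3 := Real.log_le_log (by positivity) h2
  rw [Real.log_rpow hN0] at h3
  have h4 := mul_le_mul_of_nonneg_left h3 (by positivity : 0 ≤ (W.totient : ℝ) / W)
  linarith

/-- The level sets of the transform of a function bounded by `λ_{b,W}/N`. -/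
theorem exists_levelSet_card_le {η : ℝ} (hη : 0 < η) (A : ℕ) :
    ∃ C : ℝ, 0 < C ∧ ∃ N₀ : ℕ, ∀ (N : ℕ) [NeZero N], N₀ ≤ N → 1 ≤ Real.log N ∧
      ∀ b W : ℕ, b ≤ W → 0 < W → (W : ℝ) ≤ Real.log (Real.log N) →
      ∀ a : ZMod N → ℝ, (∀ x ∈ Icc 1 N, 0 ≤ a x ∧ a x ≤ lam b W x / N) →
      ∑ r, ‖dft N a r‖ ^ 2 ≤ 4 * Real.log N ^ 2 ∧
      ∀ (s : Finset (ZMod N)) (δ : ℝ), (Real.log N ^ A)⁻¹ ≤ δ → (∀ r ∈ s, δ ≤ ‖dft N a r‖) →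
        (s.Nonempty → δ ≤ C) ∧ (δ ≤ 1 → (#s : ℝ) ≤ C * ((δ ^ 2)⁻¹ * δ ^ (-η))) := by
  obtain ⟨C₁, hC₁, hmain⟩ := exists_card_sq_mul_le_weightedEnergy
  obtain ⟨C, K, k, hC, hK, hlev⟩ :=
    exists_card_le_of_weightedEnergy (C₁ := C₁ * 96 ^ 2) (by positivity) hη
  obtain ⟨N₀, hN₀⟩ := eventually_parameters K A k
  refine ⟨C, hC, N₀, fun N _ hN => ?_⟩
  obtain ⟨hN1, hlog, hdec, hK4, h2log, hlog24⟩ := hN₀ N hN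
  refine ⟨hlog, fun b W hbW hW hWN a ha => ?_⟩
  have hN0 : (0 : ℝ) < N := by exact_mod_cast hN1
  have hW0 : (0 : ℝ) < W := by exact_mod_cast hW
  have hWlog : (W : ℝ) ≤ Real.log N := hWN.trans (Real.log_le_self (by linarith))
  have hφ0 : 0 < (W.totient : ℝ) / W :=
    div_pos (by exact_mod_cast Nat.totient_pos.2 hW) hW0
  have hφ1 : (W.totient : ℝ) / W ≤ 1 := by
    rw [div_le_one hW0]
    exact_mod_cast Nat.totient_le W
  set m := (W.totient : ℝ) / W * (2 * Real.log N) / N with hm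
  have hm0 : 0 < m := by positivity
  have hm1 : m ≤ 2 * Real.log N / N := by
    rw [hm]
    exact div_le_div_of_nonneg_right (mul_le_of_le_one_left (by positivity) hφ1) hN0.le
  have ham : ∀ x ∈ Icc 1 N, |a x| ≤ m := by
    intro x hx
    rw [abs_of_nonneg (ha x hx).1]
    refine (ha x hx).2.trans ?_
    rw [hm]
    gcongr
    refine lam_le ?_
    have h1 : (2 * W : ℝ) ≤ N := by linarith
    have h2 : 2 * W ≤ N := by exact_mod_cast h1
    rw [mem_Icc] at hx
    nlinarith
  have ha0 : ∀ x ∈ Icc 1 N, ¬ (W * x + b).Prime → a x = 0 := by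
    intro x hx hp
    obtain ⟨h1, h2⟩ := ha x hx
    rw [lam, if_neg hp, zero_div] at h2
    exact le_antisymm h2 h1
  refine ⟨?_, fun s δ hδ hs => ?_⟩
  · rw [sum_norm_dft_sq]
    calc N * ∑ x ∈ Icc 1 N, a x ^ 2 ≤ N * ∑ x ∈ Icc 1 N, (2 * Real.log N / N) ^ 2 := by
          gcongr with x hx
          · exact (ha x hx).1
          · exact (le_abs_self _).trans ((ham x hx).trans hm1)
      _ = _ := by
          rw [sum_const, Nat.card_Icc, nsmul_eq_mul, Nat.add_sub_cancel]
          field_simp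
          norm_num
  · have hA0 : 0 < Real.log N ^ A := by positivity
    have hδ0 : 0 < δ := (inv_pos.2 hA0).trans_le hδ
    set R := ⌊(N : ℝ) ^ (1 / 12 : ℝ)⌋₊ with hR
    have hN12 : (1 : ℝ) ≤ (N : ℝ) ^ (1 / 12 : ℝ) :=
      Real.one_le_rpow (by exact_mod_cast hN1) (by norm_num)
    have hRpos : 0 < R := Nat.floor_pos.2 hN12
    have hRle : (R : ℝ) ≤ (N : ℝ) ^ (1 / 12 : ℝ) := Nat.floor_le (by positivity)
    have hRN : R ^ 12 ≤ N ^ 2 := by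
      have h1 : (R : ℝ) ^ 12 ≤ N := by
        calc (R : ℝ) ^ 12 ≤ ((N : ℝ) ^ (1 / 12 : ℝ)) ^ 12 := by gcongr
          _ = (N : ℝ) := by
              rw [← Real.rpow_natCast, ← Real.rpow_mul hN0.le]
              norm_num
      have h2 : R ^ 12 ≤ N := by exact_mod_cast h1
      nlinarith
    have hRm : R * m ≤ δ / 2 := by
      have h1 : (N : ℝ) ^ (1 / 12 : ℝ) * (4 * Real.log N ^ (A + 1)) ≤ N := by
        calc _ ≤ (N : ℝ) ^ (1 / 12 : ℝ) * (N : ℝ) ^ (11 / 12 : ℝ) := by gcongr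
          _ = N := by
              rw [← Real.rpow_add hN0]
              norm_num
      calc R * m ≤ (N : ℝ) ^ (1 / 12 : ℝ) * (2 * Real.log N / N) := by gcongr
        _ = (N : ℝ) ^ (1 / 12 : ℝ) * (4 * Real.log N ^ (A + 1)) / N * (Real.log N ^ A)⁻¹ / 2 := by
            field_simp
            ring
        _ ≤ 1 * (Real.log N ^ A)⁻¹ / 2 := by
            gcongr
            rwa [div_le_one hN0]
        _ ≤ δ / 2 := by linarith
    have hmL : m * N ≤ 96 * ∑ q ∈ sieveSet W R, (q : ℝ)⁻¹ := by
      rw [hm, div_mul_cancel₀ _ hN0.ne']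
      exact mul_log_le_sum_sieveSet hN1 hW (hWlog.trans hlog24)
    have h := hmain N b W R a 96 m δ s hRpos hRN (by norm_num) hm0 hδ0 hW ha0 ham hRm hmL hs
    obtain ⟨hl1, hl2⟩ := hlev s (fun r => (ZMod.stdAddChar r : ℂ)⁻¹) N (R ^ 2) δ hN1
      (fun r _ => inv_stdAddChar_pow r) (injective_inv_stdAddChar.injOn)
      (by rw [← pow_mul]; exact hRN) hδ0 h
    refine ⟨hl1, fun hδ1 => hl2 hδ1 (le_trans ?_ hK4)⟩
    have : (δ ^ 4)⁻¹ ≤ (Real.log N ^ A) ^ 4 := by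
      rw [← inv_pow]
      gcongr
      exact inv_le_of_inv_le₀ hA0 hδ
    gcongr

end Restriction

/-- Restriction estimate of Bourgain and Green: for every `ρ > 2` there is a
constant `C'(ρ)` such that for every sufficiently large prime `N`, all coprime
positive integers `b ≤ W` with `W ≤ log log N`, every `A ⊆ {1,…,N}`, and
`a(x) = 1_A(x)·λ_{b,W}(x)/N`, one has `Σ_{r=1}^{N} |ã(r)|^ρ ≤ C'(ρ)`. -/
theorem prime_restriction (ρ : ℝ) (hρ : 2 < ρ) :
    ∃ C' : ℝ, 0 < C' ∧
    ∃ N₀ : ℕ, ∀ (N : ℕ) [NeZero N], N₀ ≤ N → N.Prime →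
    ∀ b W : ℕ, 1 ≤ b → b ≤ W → Nat.gcd b W = 1 →
      (W : ℝ) ≤ Real.log (Real.log N) →
    ∀ A : Finset ℕ, A ⊆ Finset.Icc 1 N →
    ∀ a : ZMod N → ℝ,
      (∀ x ∈ Finset.Icc 1 N,
        a ((x : ℕ) : ZMod N) = (if x ∈ A then lam b W x else 0) / N) →
    ∑ r : ZMod N, ‖dft N a r‖ ^ (ρ : ℝ) ≤ C' := by
  obtain ⟨η, hη, hρη⟩ : ∃ η : ℝ, 0 < η ∧ ρ = 2 + 2 * η := ⟨(ρ - 2) / 2, by linarith, by ring⟩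
  obtain ⟨k, hk⟩ := exists_nat_ge (1 / η)
  have hkη : 2 ≤ k * (2 * η) := by
    rw [div_le_iff₀ hη] at hk
    linarith
  obtain ⟨C, hC, N₀, hlev⟩ := exists_levelSet_card_le hη k
  have hlt : (1 / 2 : ℝ) ^ η < 1 := Real.rpow_lt_one (by norm_num) (by norm_num) hη
  have hpos : 0 < (1 - (1 / 2 : ℝ) ^ η)⁻¹ := inv_pos.2 (by linarith)
  refine ⟨4 + (C + 1) * (C + 1) ^ ρ + (C + 1) * (2 : ℝ) ^ (2 + η) * (1 - (1 / 2 : ℝ) ^ η)⁻¹,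
    by positivity, N₀, ?_⟩
  intro N _ hN _ b W hb hbW _ hWN A _ a ha
  obtain ⟨hlog, h⟩ := hlev N hN
  obtain ⟨hL2, hlevel⟩ := h b W hbW (hb.trans hbW) hWN a (by
    intro x hx
    have h0 := lam_nonneg b W x
    rw [ha x hx]
    constructor
    · split_ifs <;> positivity
    · gcongr
      split_ifs <;> simp [h0])
  have hk1 : 1 ≤ Real.log N ^ k := one_le_pow₀ hlog
  have hδ₀ : (Real.log N ^ k)⁻¹ ≤ 1 := inv_le_one_of_one_le₀ hk1
  refine sum_rpow_le_of_card_le hη hρη (by linarith) (inv_pos.2 (by linarith)) hδ₀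
    (fun r => norm_nonneg _) ?_ ?_ ?_
  · intro r
    rcases le_total ‖dft N a r‖ 1 with h1 | h1
    · linarith
    · have := (hlevel {r} ‖dft N a r‖ (hδ₀.trans h1) (by simp)).1 (singleton_nonempty r)
      linarith
  · intro δ hδ hδ1 s hs
    have hδ0 : 0 < δ := (inv_pos.2 (by linarith)).trans_le hδ
    refine ((hlevel s δ hδ hs).2 hδ1).trans ?_
    gcongr
    linarith
  · have hl0 : 0 < Real.log N := by linarith
    calc _ ≤ ((Real.log N ^ k)⁻¹) ^ (2 * η) * (4 * Real.log N ^ 2) := by gcongr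
      _ ≤ (Real.log N ^ 2)⁻¹ * (4 * Real.log N ^ 2) := by
          gcongr
          rw [Real.inv_rpow (by positivity), ← Real.rpow_natCast, ← Real.rpow_mul hl0.le,
            ← Real.rpow_two]
          refine inv_anti₀ (by positivity) ?_
          exact Real.rpow_le_rpow_of_exponent_le hlog hkη
      _ = 4 := by field_simp
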